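/- Let (W_i)_{i≥1} be an infinite exchangeable sequence of real random variables with E|W₁|³ < ∞ and E|W₁W₂| < ∞. For each m ≥ 2 let x̂_{(m)}, ŷ_{(m)} ∈ ℝ^m be unit vectors such that the inner product x̂_{(m)}·ŷ_{(m)} = cos θ is constant in m for some fixed θ ∈ [0, π], such that m^{1/4} max_{1≤i≤m} |x̂_{(m)i}| → 0 and m^{1/4} max_{1≤i≤m} |ŷ_{(m)i}| → 0 as m → ∞, and such that Σ_{i=1}^m x̂_{(m)i} → 0 and Σ_{i=1}^m ŷ_{(m)i} → 0 as m → ∞. Then lim_{m→∞} E[σ(Σ_{i=1}^m W_i x̂_{(m)i}) · σ(Σ_{i=1}^m W_i ŷ_{(m)i})] = (1/(2π)) (E[W₁²] − E[W₁W₂]) (sin θ + (π − θ) cos θ). -/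

import Mathlib

open MeasureTheory ProbabilityTheory Filter

/-- The ReLU activation. -/
noncomputable def relu (z : ℝ) : ℝ := max 0 z

/-- A sequence of real random variables is exchangeable if its joint distribution is
invariant under every finitely supported permutation of the indices. -/
def Exchangeable {Ω : Type*} [MeasurableSpace Ω] (P : Measure Ω) (Q : ℕ → Ω → ℝ) : Prop :=
  ∀ π : Equiv.Perm ℕ, {i | π i ≠ i}.Finite →
    Measure.map (fun ω => fun i => Q (π i) ω) P = Measure.map (fun ω => fun i => Q i ω) P


/-- A finitely supported permutation extending an injection on an initial segment. -/
lemma exists_perm_extend (m : ℕ) (τ : ℕ → ℕ) (hτ : Set.InjOn τ {j | j < m}) :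
    ∃ π : Equiv.Perm ℕ, {i | π i ≠ i}.Finite ∧ ∀ j < m, π j = τ j := by
  induction m with
  | zero => exact ⟨1, by simp, by simp⟩
  | succ m ih =>
    obtain ⟨π, hf, hπ⟩ := ih (hτ.mono (fun j (hj : j < m) => Nat.lt_succ_of_lt hj))
    refine ⟨Equiv.swap (π m) (τ m) * π, ?_, ?_⟩
    · refine (hf.union ((Set.finite_singleton (π m)).union (Set.finite_singleton (τ m)))).subset ?_
      intro i hi
      by_contra h
      simp only [Set.mem_union, Set.mem_ofPred_eq, Set.mem_singleton_iff, not_or, not_not] at h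
      apply hi
      simp only [Equiv.Perm.mul_apply, h.1]
      exact Equiv.swap_apply_of_ne_of_ne h.2.1 h.2.2
    · intro j hj
      rcases Nat.lt_succ_iff_lt_or_eq.1 hj with h | h
      · rw [Equiv.Perm.mul_apply, Equiv.swap_apply_of_ne_of_ne, hπ j h]
        · intro h2
          exact h.ne (π.injective h2)
        · rw [hπ j h]
          intro h2
          exact h.ne (hτ hj (by simp) h2)
      · subst h
        simp

/-- Any finite family of distinct members has the law of the initial segment. -/
lemma exch_ident {Ω : Type*} [MeasurableSpace Ω] {P : Measure Ω} {W : ℕ → Ω → ℝ}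
    (hW : ∀ i, Measurable (W i)) (hex : Exchangeable P W) {m : ℕ} (τ : Fin m → ℕ)
    (hτ : Function.Injective τ) :
    IdentDistrib (fun ω (j : Fin m) => W (τ j) ω) (fun ω (j : Fin m) => W j ω) P P := by
  obtain ⟨π, hf, hπ⟩ := exists_perm_extend m (fun j => if h : j < m then τ ⟨j, h⟩ else 0) (by
    intro i hi j hj h
    simp only [Set.mem_ofPred_eq] at hi hj
    simp only [hi, hj, dif_pos] at h
    simpa using hτ h)
  have h := hex π hf
  have hid : IdentDistrib (fun ω => fun i => W (π i) ω) (fun ω => fun i => W i ω) P P :=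
    ⟨by fun_prop, by fun_prop, h⟩
  have h2 := hid.comp (u := fun (z : ℕ → ℝ) (j : Fin m) => z j) (by fun_prop)
  have e : (fun ω (j : Fin m) => W (τ j) ω)
      = (fun (z : ℕ → ℝ) (j : Fin m) => z j) ∘ (fun ω => fun i => W (π i) ω) := by
    ext ω j
    simp [hπ j j.2]
  rw [e]
  exact h2

lemma exch_one {Ω : Type*} [MeasurableSpace Ω] {P : Measure Ω} {W : ℕ → Ω → ℝ}
    (hW : ∀ i, Measurable (W i)) (hex : Exchangeable P W) (i : ℕ) :
    IdentDistrib (W i) (W 0) P P := by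
  have := (exch_ident hW hex (m := 1) (fun _ => i) (fun a b _ => Subsingleton.elim a b)).comp
    (u := fun z => z 0) (by fun_prop)
  exact this

lemma exch_two {Ω : Type*} [MeasurableSpace Ω] {P : Measure Ω} {W : ℕ → Ω → ℝ}
    (hW : ∀ i, Measurable (W i)) (hex : Exchangeable P W) {i j : ℕ} (hij : i ≠ j) :
    IdentDistrib (fun ω => (W i ω, W j ω)) (fun ω => (W 0 ω, W 1 ω)) P P := by
  have := (exch_ident hW hex (m := 2) ![i, j] (by
    intro a b
    fin_cases a <;> fin_cases b <;> simp [hij, hij.symm])).comp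
    (u := fun z => (z 0, z 1)) (by fun_prop)
  exact this

/-- Second moment of a linear combination. -/
lemma sq_moment {Ω ι : Type*} [MeasurableSpace Ω] {P : Measure Ω} [DecidableEq ι]
    (s : Finset ι) (Y : ι → Ω → ℝ) (hY : ∀ i, MemLp (Y i) 2 P) (a b : ℝ)
    (ha : ∀ i, ∫ ω, Y i ω * Y i ω ∂P = a) (hb : ∀ i j, i ≠ j → ∫ ω, Y i ω * Y j ω ∂P = b)
    (c : ι → ℝ) :
    ∫ ω, (∑ i ∈ s, c i * Y i ω) ^ 2 ∂P
      = (∑ i ∈ s, c i ^ 2) * (a - b) + (∑ i ∈ s, c i) ^ 2 * b := by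
  have hIntg : ∀ i j, Integrable (fun ω => c i * c j * (Y i ω * Y j ω)) P := fun i j =>
    ((hY i).integrable_mul (hY j)).const_mul _
  have e1 : ∀ ω, (∑ i ∈ s, c i * Y i ω) ^ 2 = ∑ i ∈ s, ∑ j ∈ s, c i * c j * (Y i ω * Y j ω) := by
    intro ω
    rw [sq, Finset.sum_mul_sum]
    refine Finset.sum_congr rfl fun i _ => Finset.sum_congr rfl fun j _ => by ring
  simp_rw [e1]
  rw [integral_finsetSum _ (fun i _ => integrable_finsetSum _ fun j _ => hIntg i j)]
  have e2 : ∀ i ∈ s, ∫ ω, ∑ j ∈ s, c i * c j * (Y i ω * Y j ω) ∂P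
      = c i ^ 2 * (a - b) + c i * (∑ j ∈ s, c j) * b := by
    intro i hi
    rw [integral_finsetSum _ (fun j _ => hIntg i j)]
    have e3 : ∀ j ∈ s, ∫ ω, c i * c j * (Y i ω * Y j ω) ∂P
        = (if i = j then c i ^ 2 * (a - b) else 0) + c i * c j * b := by
      intro j _
      rw [integral_const_mul]
      split_ifs with h
      · subst h
        rw [ha]; ring
      · rw [hb i j h]; ring
    rw [Finset.sum_congr rfl e3, Finset.sum_add_distrib, Finset.sum_ite_eq, if_pos hi,
      Finset.mul_sum, Finset.sum_mul]
  rw [Finset.sum_congr rfl e2, Finset.sum_add_distrib, ← Finset.sum_mul, ← Finset.sum_mul,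
    ← Finset.sum_mul]
  ring

noncomputable def avg (S : Finset ℕ) (u : ℕ → ℝ) : ℝ := (∑ i ∈ S, u i) / (S.card : ℝ)

noncomputable def evar (S : Finset ℕ) (u : ℕ → ℝ) : ℝ :=
  avg S (fun i => u i ^ 2) - (avg S u) ^ 2

lemma avg_mono {S : Finset ℕ} {u v : ℕ → ℝ} (h : ∀ i, u i ≤ v i) : avg S u ≤ avg S v := by
  unfold avg
  gcongr
  exact h _

lemma avg_add (S : Finset ℕ) (u v : ℕ → ℝ) : avg S (fun i => u i + v i) = avg S u + avg S v := by
  unfold avg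
  rw [Finset.sum_add_distrib, add_div]

lemma avg_mul (S : Finset ℕ) (c : ℝ) (u : ℕ → ℝ) : avg S (fun i => c * u i) = c * avg S u := by
  unfold avg
  rw [← Finset.mul_sum, mul_div_assoc]

lemma avg_const {S : Finset ℕ} (hS : S.Nonempty) (c : ℝ) : avg S (fun _ => c) = c := by
  unfold avg
  have : (S.card : ℝ) ≠ 0 := by simpa using hS.ne_empty
  simp
  field_simp

lemma abs_avg_le (S : Finset ℕ) (u : ℕ → ℝ) : |avg S u| ≤ avg S (fun i => |u i|) := by
  unfold avg
  rw [abs_div, Nat.abs_cast]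
  gcongr
  exact Finset.abs_sum_le_sum_abs _ _

lemma avg_nonneg {S : Finset ℕ} {u : ℕ → ℝ} (h : ∀ i, 0 ≤ u i) : 0 ≤ avg S u := by
  unfold avg
  have := Finset.sum_nonneg (s := S) (fun i _ => h i)
  positivity

lemma evar_eq {S : Finset ℕ} (hS : S.Nonempty) (u : ℕ → ℝ) :
    evar S u = avg S (fun i => (u i - avg S u) ^ 2) := by
  have : (fun i => (u i - avg S u) ^ 2)
      = fun i => (u i ^ 2 + (- 2 * avg S u) * u i) + (avg S u) ^ 2 := by
    ext i; ring
  rw [this, avg_add, avg_add, avg_mul, avg_const hS]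
  unfold evar
  ring

lemma evar_nonneg {S : Finset ℕ} (hS : S.Nonempty) (u : ℕ → ℝ) : 0 ≤ evar S u := by
  rw [evar_eq hS]
  exact avg_nonneg fun i => sq_nonneg _

lemma avg_cube_ge {S : Finset ℕ} (hS : S.Nonempty) (u : ℕ → ℝ) :
    |avg S u| ^ 3 ≤ avg S (fun i => |u i| ^ 3) := by
  set r := avg S (fun i => |u i|) with hr
  have hr0 : 0 ≤ r := avg_nonneg fun i => abs_nonneg _
  have h1 : |avg S u| ^ 3 ≤ r ^ 3 := by
    gcongr
    exact abs_avg_le S u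
  have h2 : avg S (fun i => (3 * r ^ 2) * |u i| + (-2 * r ^ 3)) ≤ avg S (fun i => |u i| ^ 3) := by
    apply avg_mono
    intro i
    nlinarith [mul_nonneg (sq_nonneg (|u i| - r)) (by positivity : 0 ≤ |u i| + 2 * r)]
  rw [avg_add, avg_mul, avg_const hS, ← hr] at h2
  linarith

lemma avg_sq_ge {S : Finset ℕ} (hS : S.Nonempty) (u : ℕ → ℝ) :
    (√(avg S (fun i => u i ^ 2))) ^ 3 ≤ avg S (fun i => |u i| ^ 3) := by
  set r := √(avg S (fun i => u i ^ 2)) with hr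
  have hr0 : 0 ≤ r := Real.sqrt_nonneg _
  have hr2 : avg S (fun i => u i ^ 2) = r ^ 2 :=
    (Real.sq_sqrt (avg_nonneg fun i => sq_nonneg _)).symm
  have h2 : avg S (fun i => (3 / 2 * r) * u i ^ 2 + (-(1 / 2) * r ^ 3))
      ≤ avg S (fun i => |u i| ^ 3) := by
    apply avg_mono
    intro i
    rw [← sq_abs]
    nlinarith [mul_nonneg (sq_nonneg (|u i| - r)) (by positivity : 0 ≤ 2 * |u i| + r)]
  rw [avg_add, avg_mul, avg_const hS, hr2] at h2
  linarith

lemma exp_taylor (u : ℝ) :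
    ‖Complex.exp (Complex.I * u) - (1 + Complex.I * u - u ^ 2 / 2)‖ ≤ 4 * |u| ^ 3 := by
  rcases le_or_gt |u| 1 with h | h
  · have := Complex.exp_bound (x := Complex.I * u) (by simpa using h) (n := 3) (by norm_num)
    simp only [Finset.sum_range_succ, Finset.sum_range_zero] at this
    norm_num [Nat.factorial] at this
    have e : (0 + 1 + Complex.I * u + (Complex.I * u) ^ 2 / 2 : ℂ)
        = 1 + Complex.I * u - u ^ 2 / 2 := by
      rw [mul_pow, Complex.I_sq]; ring
    have h3 : 0 ≤ |u| ^ 3 := by positivity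
    rw [mul_pow, Complex.I_sq] at this
    ring_nf at this ⊢
    nlinarith
  · have h1 : ‖Complex.exp (Complex.I * u)‖ = 1 := Complex.norm_exp_I_mul_ofReal u
    have h2 : ‖(1 + Complex.I * u - u ^ 2 / 2 : ℂ)‖ ≤ 1 + |u| + |u| ^ 2 / 2 := by
      refine (norm_sub_le _ _).trans ?_
      gcongr
      · refine (norm_add_le _ _).trans ?_
        simp
      · simp
    have h3 := norm_sub_le (Complex.exp (Complex.I * u)) (1 + Complex.I * u - u ^ 2 / 2)
    have h4 : |u| ≤ |u| ^ 3 := by nlinarith [sq_nonneg (|u| - 1)]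
    have h5 : |u| ^ 2 ≤ |u| ^ 3 := by nlinarith [sq_nonneg (|u|)]
    linarith

lemma exp_neg_taylor {s r : ℝ} (hs : 0 ≤ s) (hr : 0 ≤ r) (hsr : s ≤ r ^ 2) :
    |Real.exp (-s) - (1 - s)| ≤ r ^ 3 := by
  have h1 : 1 - s ≤ Real.exp (-s) := by linarith [Real.add_one_le_exp (-s)]
  rw [abs_of_nonneg (by linarith)]
  rcases le_or_gt r 1 with h | h
  · have hs1 : s ≤ 1 := by nlinarith
    have := Real.abs_exp_sub_one_sub_id_le (x := -s) (by rw [abs_neg, abs_of_nonneg hs]; exact hs1)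
    have h2 := (abs_le.1 this).2
    have h3 : s ^ 2 ≤ (r ^ 2) ^ 2 := by gcongr
    have h4 : (r ^ 2) ^ 2 ≤ r ^ 3 := by
      have : 0 ≤ r ^ 3 := by positivity
      nlinarith
    nlinarith
  · have h2 : Real.exp (-s) ≤ 1 := by simpa using hs
    have : r ^ 2 ≤ r ^ 3 := by nlinarith [sq_nonneg r]
    linarith

/-- Empirical characteristic function versus Gaussian. -/
lemma emp_char {S : Finset ℕ} (hS : S.Nonempty) (w : ℕ → ℝ) (t : ℝ) :
    ‖(∑ i ∈ S, Complex.exp (Complex.I * (t * w i : ℝ))) / (S.card : ℂ)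
      - Complex.exp (Complex.I * (t * avg S w : ℝ) - (t ^ 2 * evar S w / 2 : ℝ))‖
      ≤ 33 * |t| ^ 3 * avg S (fun i => |w i| ^ 3) := by
  set M := avg S w with hM
  set V := evar S w with hV
  set B := avg S (fun i => |w i| ^ 3) with hB
  have hc : (S.card : ℂ) ≠ 0 := by simpa using hS.ne_empty
  have hcr : (S.card : ℝ) ≠ 0 := by simpa using hS.ne_empty
  have hVn : 0 ≤ V := evar_nonneg hS w
  set u : ℕ → ℝ := fun i => t * (w i - M) with hu
  -- centred version
  have key : ‖(∑ i ∈ S, Complex.exp (Complex.I * (u i : ℝ))) / (S.card : ℂ)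
      - Complex.exp (-(t ^ 2 * V / 2 : ℝ))‖ ≤ 33 * |t| ^ 3 * B := by
    have h1 : ‖(∑ i ∈ S, Complex.exp (Complex.I * (u i : ℝ))) / (S.card : ℂ)
        - (1 - (t ^ 2 * V / 2 : ℝ))‖ ≤ 32 * |t| ^ 3 * B := by
      have e0 : avg S (fun i => 1 + (-(1/2)) * u i ^ 2) = 1 - t ^ 2 * V / 2 := by
        rw [avg_add, avg_const hS, avg_mul]
        have : (fun i => u i ^ 2) = fun i => t ^ 2 * (w i - M) ^ 2 := by
          ext i; simp only [hu]; ring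
        rw [this, avg_mul, hV, evar_eq hS]
        ring
      have e0' : avg S u = 0 := by
        have : u = fun i => t * w i + (- (t * M)) := by ext i; simp only [hu]; ring
        rw [this, avg_add, avg_mul, avg_const hS]; ring
      have e1 : ((1 - (t ^ 2 * V / 2 : ℝ) : ℂ))
          = (∑ i ∈ S, (1 + Complex.I * (u i) - (u i) ^ 2 / 2)) / (S.card : ℂ) := by
        have a1 : ((1 - (t ^ 2 * V / 2 : ℝ) : ℂ)) = ((1 - t ^ 2 * V / 2 : ℝ) : ℂ)
            + Complex.I * ((0 : ℝ) : ℂ) := by push_cast; ring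
        rw [a1, ← e0, ← e0']
        unfold avg
        push_cast
        rw [← mul_div_assoc, ← add_div, Finset.mul_sum, ← Finset.sum_add_distrib]
        congr 1
        refine Finset.sum_congr rfl fun i _ => by ring
      rw [e1, ← sub_div, ← Finset.sum_sub_distrib, norm_div]
      have e2 : ‖∑ i ∈ S, (Complex.exp (Complex.I * (u i : ℝ))
          - (1 + Complex.I * (u i) - (u i) ^ 2 / 2))‖ ≤ ∑ i ∈ S, 4 * |u i| ^ 3 :=
        (norm_sum_le _ _).trans (Finset.sum_le_sum fun i _ => exp_taylor (u i))
      have e3 : avg S (fun i => 4 * |u i| ^ 3) ≤ 32 * |t| ^ 3 * B := by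
        have : ∀ i, 4 * |u i| ^ 3 ≤ (16 * |t| ^ 3) * |w i| ^ 3 + 16 * |t| ^ 3 * |M| ^ 3 := by
          intro i
          have a1 : |u i| ≤ |t| * (|w i| + |M|) := by
            simp only [hu, abs_mul]
            gcongr
            exact abs_sub _ _
          have a2 : |u i| ^ 3 ≤ (|t| * (|w i| + |M|)) ^ 3 := by gcongr
          have a3 : (|w i| + |M|) ^ 3 ≤ 4 * (|w i| ^ 3 + |M| ^ 3) := by
            nlinarith [mul_nonneg (sq_nonneg (|w i| - |M|))
              (by positivity : 0 ≤ |w i| + |M|)]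
          rw [mul_pow] at a2
          have a4 : |t| ^ 3 * (|w i| + |M|) ^ 3 ≤ |t| ^ 3 * (4 * (|w i| ^ 3 + |M| ^ 3)) := by
            gcongr
          linarith
        have a5 := avg_mono (S := S) this
        rw [avg_add, avg_mul (c := 16 * |t| ^ 3), avg_const hS] at a5
        have a6 : |M| ^ 3 ≤ B := avg_cube_ge hS w
        have a7 : 16 * |t| ^ 3 * |M| ^ 3 ≤ 16 * |t| ^ 3 * B := by gcongr
        linarith
      have : ‖(S.card : ℂ)‖ = (S.card : ℝ) := by simp
      rw [this]
      refine le_trans ?_ e3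
      unfold avg
      gcongr
    have h2 : ‖Complex.exp (-(t ^ 2 * V / 2 : ℝ)) - (1 - (t ^ 2 * V / 2 : ℝ))‖ ≤ |t| ^ 3 * B := by
      have e : Complex.exp (-(t ^ 2 * V / 2 : ℝ)) - (1 - (t ^ 2 * V / 2 : ℝ))
          = ((Real.exp (-(t ^ 2 * V / 2)) - (1 - t ^ 2 * V / 2) : ℝ) : ℂ) := by
        push_cast; ring
      rw [e, Complex.norm_real, Real.norm_eq_abs]
      have hQ0 : 0 ≤ avg S (fun i => w i ^ 2) := avg_nonneg fun i => sq_nonneg _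
      refine (exp_neg_taylor (r := |t| * √(avg S (fun i => w i ^ 2))) (by positivity)
        (by positivity) ?_).trans ?_
      · rw [mul_pow, Real.sq_sqrt hQ0, sq_abs]
        have : V ≤ avg S (fun i => w i ^ 2) := by
          rw [hV]; unfold evar; nlinarith [sq_nonneg (avg S w)]
        nlinarith [mul_le_mul_of_nonneg_left this (sq_nonneg t), mul_nonneg (sq_nonneg t) hVn]
      · rw [mul_pow]
        gcongr
        exact avg_sq_ge hS w
    calc _ = ‖((∑ i ∈ S, Complex.exp (Complex.I * (u i : ℝ))) / (S.card : ℂ)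
        - (1 - (t ^ 2 * V / 2 : ℝ))) - (Complex.exp (-(t ^ 2 * V / 2 : ℝ))
          - (1 - (t ^ 2 * V / 2 : ℝ)))‖ := by congr 1; ring
      _ ≤ _ := norm_sub_le _ _
      _ ≤ _ := by linarith
  have hfac : (∑ i ∈ S, Complex.exp (Complex.I * (t * w i : ℝ))) / (S.card : ℂ)
      - Complex.exp (Complex.I * (t * M : ℝ) - (t ^ 2 * V / 2 : ℝ))
      = Complex.exp (Complex.I * (t * M : ℝ)) *
        ((∑ i ∈ S, Complex.exp (Complex.I * (u i : ℝ))) / (S.card : ℂ)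
      - Complex.exp (-(t ^ 2 * V / 2 : ℝ))) := by
    rw [mul_sub, ← Complex.exp_add, ← mul_div_assoc, Finset.mul_sum, sub_eq_add_neg
      (Complex.I * (t * M : ℝ))]
    congr 2
    refine Finset.sum_congr rfl fun i _ => ?_
    rw [← Complex.exp_add]
    congr 1
    simp only [hu]
    push_cast
    ring
  rw [hfac, norm_mul, Complex.norm_exp_I_mul_ofReal, one_mul]
  exact key

section averages

set_option linter.unusedSectionVars false

variable {Ω : Type*} [MeasurableSpace Ω] {P : Measure Ω} [IsProbabilityMeasure P]
  {W : ℕ → Ω → ℝ}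

lemma integrable_avg (S : Finset ℕ) (Y : ℕ → Ω → ℝ) (h : ∀ i, Integrable (Y i) P) :
    Integrable (fun ω => avg S (fun i => Y i ω)) P := by
  unfold avg
  exact (integrable_finsetSum _ fun i _ => h i).div_const _

lemma integral_avg {S : Finset ℕ} (hS : S.Nonempty) (Y : ℕ → Ω → ℝ) (h : ∀ i, Integrable (Y i) P)
    (a : ℝ) (ha : ∀ i, ∫ ω, Y i ω ∂P = a) :
    ∫ ω, avg S (fun i => Y i ω) ∂P = a := by
  unfold avg
  rw [integral_div, integral_finsetSum _ fun i _ => h i]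
  simp only [ha]
  have : (S.card : ℝ) ≠ 0 := by simpa using hS.ne_empty
  simp
  field_simp

lemma memLp_avg (S : Finset ℕ) (Y : ℕ → Ω → ℝ) (h : ∀ i, MemLp (Y i) 2 P) :
    MemLp (fun ω => avg S (fun i => Y i ω)) 2 P := by
  have : (fun ω => avg S (fun i => Y i ω)) = fun ω => ∑ i ∈ S, (S.card : ℝ)⁻¹ * Y i ω := by
    ext ω
    unfold avg
    rw [← Finset.mul_sum]; ring
  rw [this]
  exact memLp_finsetSum _ fun i _ => (h i).const_mul _

lemma avg_l2 (Y : ℕ → Ω → ℝ) (hY : ∀ i, MemLp (Y i) 2 P) (a b : ℝ)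
    (ha : ∀ i, ∫ ω, Y i ω * Y i ω ∂P = a) (hb : ∀ i j, i ≠ j → ∫ ω, Y i ω * Y j ω ∂P = b)
    {S T : Finset ℕ} (hS : S.Nonempty) (hT : T.Nonempty) :
    ∫ ω, (avg S (fun i => Y i ω) - avg T (fun i => Y i ω)) ^ 2 ∂P
      ≤ 2 * |a - b| * (1 / (S.card : ℝ) + 1 / (T.card : ℝ)) := by
  classical
  have hcS : (0 : ℝ) < S.card := by simpa using hS.card_pos
  have hcT : (0 : ℝ) < T.card := by simpa using hT.card_pos
  set c : ℕ → ℝ := fun i => (if i ∈ S then (S.card : ℝ)⁻¹ else 0)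
    - (if i ∈ T then (T.card : ℝ)⁻¹ else 0) with hc
  have hsS : ∀ f : ℕ → ℝ, ∑ i ∈ S ∪ T, (if i ∈ S then f i else 0) = ∑ i ∈ S, f i := by
    intro f
    rw [← Finset.sum_filter]
    congr 1
    ext i; simp
  have hsT : ∀ f : ℕ → ℝ, ∑ i ∈ S ∪ T, (if i ∈ T then f i else 0) = ∑ i ∈ T, f i := by
    intro f
    rw [← Finset.sum_filter]
    congr 1
    ext i; simp
  have e1 : ∀ ω, avg S (fun i => Y i ω) - avg T (fun i => Y i ω)
      = ∑ i ∈ S ∪ T, c i * Y i ω := by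
    intro ω
    simp only [hc, sub_mul, Finset.sum_sub_distrib, ite_mul, zero_mul]
    rw [hsS, hsT, ← Finset.mul_sum, ← Finset.mul_sum]
    unfold avg
    ring
  have e2 : ∑ i ∈ S ∪ T, c i = 0 := by
    simp only [hc, Finset.sum_sub_distrib]
    rw [hsS, hsT]
    simp [hcS.ne', hcT.ne']
  have e3 : ∑ i ∈ S ∪ T, c i ^ 2 ≤ 2 * (1 / (S.card : ℝ) + 1 / (T.card : ℝ)) := by
    have : ∀ i ∈ S ∪ T, c i ^ 2 ≤ (if i ∈ S then 2 * ((S.card : ℝ)⁻¹) ^ 2 else 0)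
        + (if i ∈ T then 2 * ((T.card : ℝ)⁻¹) ^ 2 else 0) := by
      intro i _
      have hs := inv_pos.2 hcS
      have ht := inv_pos.2 hcT
      simp only [hc]
      split_ifs <;> nlinarith [sq_nonneg ((S.card : ℝ)⁻¹ + (T.card : ℝ)⁻¹)]
    refine (Finset.sum_le_sum this).trans ?_
    rw [Finset.sum_add_distrib, hsS, hsT]
    simp only [Finset.sum_const, nsmul_eq_mul]
    apply le_of_eq
    field_simp
  simp_rw [e1]
  rw [sq_moment _ Y hY a b ha hb, e2]
  have := abs_nonneg (a - b)
  have h5 : 0 ≤ ∑ i ∈ S ∪ T, c i ^ 2 := Finset.sum_nonneg fun i _ => sq_nonneg _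
  have h4 := le_abs_self (a - b)
  calc _ = (∑ i ∈ S ∪ T, c i ^ 2) * (a - b) := by ring
    _ ≤ (∑ i ∈ S ∪ T, c i ^ 2) * |a - b| := by gcongr
    _ ≤ (2 * (1 / (S.card : ℝ) + 1 / (T.card : ℝ))) * |a - b| := by gcongr
    _ = _ := by ring

lemma avg_l2_small (Y : ℕ → Ω → ℝ) (hY : ∀ i, MemLp (Y i) 2 P) (a b : ℝ)
    (ha : ∀ i, ∫ ω, Y i ω * Y i ω ∂P = a) (hb : ∀ i j, i ≠ j → ∫ ω, Y i ω * Y j ω ∂P = b)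
    {ε : ℝ} (hε : 0 < ε) :
    ∃ N : ℕ, 0 < N ∧ ∀ S T : Finset ℕ, N ≤ S.card → N ≤ T.card →
      ∫ ω, (avg S (fun i => Y i ω) - avg T (fun i => Y i ω)) ^ 2 ∂P ≤ ε := by
  obtain ⟨N, hN⟩ := exists_nat_gt (4 * |a - b| / ε)
  refine ⟨N + 1, by omega, fun S T hS hT => ?_⟩
  have hS' : S.Nonempty := Finset.card_pos.1 (by omega)
  have hT' : T.Nonempty := Finset.card_pos.1 (by omega)
  refine (avg_l2 Y hY a b ha hb hS' hT').trans ?_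
  have hN0 : (0 : ℝ) < N + 1 := by positivity
  have h1 : 1 / (S.card : ℝ) ≤ 1 / (N + 1 : ℝ) := by
    apply one_div_le_one_div_of_le hN0; exact_mod_cast hS
  have h2 : 1 / (T.card : ℝ) ≤ 1 / (N + 1 : ℝ) := by
    apply one_div_le_one_div_of_le hN0; exact_mod_cast hT
  have := abs_nonneg (a - b)
  calc _ ≤ 2 * |a - b| * (1 / (N + 1 : ℝ) + 1 / (N + 1 : ℝ)) := by gcongr
    _ = (4 * |a - b|) / (N + 1) := by ring
    _ ≤ ε := by
      rw [div_le_iff₀ hN0]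
      rw [div_lt_iff₀ hε] at hN
      nlinarith

lemma abs_le_sq_add {ε : ℝ} (hε : 0 < ε) (d : ℝ) : |d| ≤ ε + d ^ 2 / ε := by
  rw [← sq_abs d]
  have := abs_nonneg d
  rw [← sub_nonneg]
  have e : ε + |d| ^ 2 / ε - |d| = (ε ^ 2 + |d| ^ 2 - |d| * ε) / ε := by field_simp
  rw [e]
  apply div_nonneg _ hε.le
  nlinarith [sq_nonneg (ε - |d|), mul_nonneg this hε.le]

lemma avg_l1_of_l2 (Y : ℕ → Ω → ℝ) (hY : ∀ i, MemLp (Y i) 2 P) (a b : ℝ)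
    (ha : ∀ i, ∫ ω, Y i ω * Y i ω ∂P = a) (hb : ∀ i j, i ≠ j → ∫ ω, Y i ω * Y j ω ∂P = b)
    {ε : ℝ} (hε : 0 < ε) :
    ∃ N : ℕ, 0 < N ∧ ∀ S T : Finset ℕ, N ≤ S.card → N ≤ T.card →
      ∫ ω, |avg S (fun i => Y i ω) - avg T (fun i => Y i ω)| ∂P ≤ ε := by
  obtain ⟨N, hN0, hN⟩ := avg_l2_small Y hY a b ha hb (ε := (ε / 2) ^ 2) (by positivity)
  refine ⟨N, hN0, fun S T hS hT => ?_⟩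
  have hm : MemLp (fun ω => avg S (fun i => Y i ω) - avg T (fun i => Y i ω)) 2 P :=
    (memLp_avg S Y hY).sub (memLp_avg T Y hY)
  have hi2 := hm.integrable_sq
  have hi1 := hm.integrable (by norm_num)
  calc _ ≤ ∫ ω, (ε / 2 + (avg S (fun i => Y i ω) - avg T (fun i => Y i ω)) ^ 2 / (ε / 2)) ∂P := by
        apply integral_mono hi1.abs ((integrable_const _).add (hi2.div_const _))
        intro ω
        exact abs_le_sq_add (by positivity) _
    _ = ε / 2 + (∫ ω, (avg S (fun i => Y i ω) - avg T (fun i => Y i ω)) ^ 2 ∂P) / (ε / 2) := by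
        rw [integral_add (integrable_const _) (hi2.div_const _)]
        simp [integral_div]
    _ ≤ ε / 2 + (ε / 2) ^ 2 / (ε / 2) := by
        gcongr
        exact hN S T hS hT
    _ = ε := by field_simp; ring

/-- Averages of an integrable function of an exchangeable sequence are Cauchy in `L¹`. -/
lemma avg_l1 (hW : ∀ i, Measurable (W i)) (hex : Exchangeable P W) (g : ℝ → ℝ)
    (hg : Measurable g) (hIntg : Integrable (fun ω => g (W 0 ω)) P) {ε : ℝ} (hε : 0 < ε) :
    ∃ N : ℕ, 0 < N ∧ ∀ S T : Finset ℕ, N ≤ S.card → N ≤ T.card →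
      ∫ ω, |avg S (fun i => g (W i ω)) - avg T (fun i => g (W i ω))| ∂P ≤ ε := by
  -- truncation
  set gk : ℕ → ℝ → ℝ := fun k z => max (-(k : ℝ)) (min (g z) k) with hgk
  have hgkm : ∀ k, Measurable (gk k) := fun k => by
    simp only [hgk]; fun_prop
  have hgkb : ∀ k z, |gk k z| ≤ k := by
    intro k z
    rw [abs_le]
    refine ⟨le_max_left _ _, max_le ?_ (min_le_right _ _)⟩
    have : (0 : ℝ) ≤ k := Nat.cast_nonneg k
    linarith
  have hgkd : ∀ k z, |g z - gk k z| ≤ |g z| := by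
    intro k z
    have hk : (0 : ℝ) ≤ k := Nat.cast_nonneg k
    simp only [hgk]
    rcases le_total (g z) k with h1 | h1
    · rw [min_eq_left h1]
      rcases le_total (-(k : ℝ)) (g z) with h2 | h2
      · rw [max_eq_right h2]; simp
      · rw [max_eq_left h2, abs_of_nonpos (by linarith), abs_of_nonpos (by linarith)]; linarith
    · rw [min_eq_right h1, max_eq_right (by linarith), abs_of_nonneg (by linarith),
        abs_of_nonneg (by linarith)]; linarith
  have hlim : Tendsto (fun k : ℕ => ∫ ω, |g (W 0 ω) - gk k (W 0 ω)| ∂P) atTop (nhds 0) := by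
    have := tendsto_integral_of_dominated_convergence (μ := P)
      (F := fun k ω => |g (W 0 ω) - gk k (W 0 ω)|) (f := fun _ => 0) (fun ω => |g (W 0 ω)|)
      (fun k => by
        have := hgkm k
        have := hW 0
        exact Measurable.aestronglyMeasurable (by fun_prop)) hIntg.abs
      (fun k => Eventually.of_forall fun ω => by
        simp only [Real.norm_eq_abs, abs_abs]
        exact hgkd k _)
      (Eventually.of_forall fun ω => by
        obtain ⟨K, hK⟩ := exists_nat_ge |g (W 0 ω)|
        apply tendsto_const_nhds.congr'
        filter_upwards [eventually_ge_atTop K] with k hk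
        have h1 : |g (W 0 ω)| ≤ k := hK.trans (by exact_mod_cast hk)
        simp only [hgk]
        rw [min_eq_left (abs_le.1 h1).2, max_eq_right (abs_le.1 h1).1]
        simp)
    simpa using this
  obtain ⟨k, hk⟩ := (hlim.eventually_lt_const (by positivity : (0 : ℝ) < ε / 3)).exists
  have hL2 : ∀ i, MemLp (fun ω => gk k (W i ω)) 2 P := fun i =>
    MemLp.of_bound ((hgkm k).comp (hW i)).aestronglyMeasurable k
      (Eventually.of_forall fun ω => hgkb k _)
  obtain ⟨N, hN0, hN⟩ := avg_l1_of_l2 (fun i ω => gk k (W i ω)) hL2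
    (∫ ω, gk k (W 0 ω) * gk k (W 0 ω) ∂P) (∫ ω, gk k (W 0 ω) * gk k (W 1 ω) ∂P)
    (fun i => ((exch_one hW hex i).comp (u := fun z => gk k z * gk k z)
      ((hgkm k).mul (hgkm k))).integral_eq)
    (fun i j hij => ((exch_two hW hex hij).comp (u := fun z : ℝ × ℝ => gk k z.1 * gk k z.2)
      (by have := hgkm k; fun_prop)).integral_eq)
    (ε := ε / 3) (by positivity)
  refine ⟨N, hN0, fun S T hS hT => ?_⟩
  have hgi : ∀ i, Integrable (fun ω => g (W i ω)) P := fun i =>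
    (((exch_one hW hex i).comp (u := g) hg).integrable_iff).2 hIntg
  have hgki : ∀ i, Integrable (fun ω => gk k (W i ω)) P := fun i =>
    (hL2 i).integrable (by norm_num)
  have hd : ∀ U : Finset ℕ, U.Nonempty →
      ∫ ω, avg U (fun i => |g (W i ω) - gk k (W i ω)|) ∂P ≤ ε / 3 := by
    intro U hU
    rw [integral_avg hU (fun i ω => |g (W i ω) - gk k (W i ω)|)
      (fun i => ((hgi i).sub (hgki i)).abs) _ (fun i =>
      ((exch_one hW hex i).comp (u := fun z => |g z - gk k z|)
      (by have := hgkm k; fun_prop)).integral_eq)]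
    exact hk.le
  have hS' : S.Nonempty := Finset.card_pos.1 (by omega)
  have hT' : T.Nonempty := Finset.card_pos.1 (by omega)
  have iS : Integrable (fun ω => avg S (fun i => |g (W i ω) - gk k (W i ω)|)) P :=
    integrable_avg S _ (fun i => ((hgi i).sub (hgki i)).abs)
  have iT : Integrable (fun ω => avg T (fun i => |g (W i ω) - gk k (W i ω)|)) P :=
    integrable_avg T _ (fun i => ((hgi i).sub (hgki i)).abs)
  have iD : Integrable (fun ω => |avg S (fun i => gk k (W i ω)) - avg T (fun i => gk k (W i ω))|) P :=
    ((integrable_avg S _ hgki).sub (integrable_avg T _ hgki)).abs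
  have hpt : ∀ (U : Finset ℕ) ω, |avg U (fun i => g (W i ω)) - avg U (fun i => gk k (W i ω))|
      ≤ avg U (fun i => |g (W i ω) - gk k (W i ω)|) := by
    intro U ω
    refine le_trans (le_of_eq ?_) (abs_avg_le U _)
    congr 1
    unfold avg
    rw [Finset.sum_sub_distrib, sub_div]
  calc _ ≤ ∫ ω, (avg S (fun i => |g (W i ω) - gk k (W i ω)|)
        + |avg S (fun i => gk k (W i ω)) - avg T (fun i => gk k (W i ω))|
        + avg T (fun i => |g (W i ω) - gk k (W i ω)|)) ∂P := by
        apply integral_mono ((integrable_avg S _ hgi).sub (integrable_avg T _ hgi)).abs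
          ((iS.add iD).add iT)
        intro ω
        have h1 := hpt S ω
        have h2 := hpt T ω
        rw [abs_sub_comm] at h2
        have := abs_add_three (avg S (fun i => g (W i ω)) - avg S (fun i => gk k (W i ω)))
          (avg S (fun i => gk k (W i ω)) - avg T (fun i => gk k (W i ω)))
          (avg T (fun i => gk k (W i ω)) - avg T (fun i => g (W i ω)))
        simp only [sub_add_sub_cancel] at this
        simp only [Pi.add_apply, Pi.sub_apply]
        linarith
    _ = (∫ ω, avg S (fun i => |g (W i ω) - gk k (W i ω)|) ∂P)
        + (∫ ω, |avg S (fun i => gk k (W i ω)) - avg T (fun i => gk k (W i ω))| ∂P)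
        + ∫ ω, avg T (fun i => |g (W i ω) - gk k (W i ω)|) ∂P := by
        have h1 := integral_add (iS.add iD) iT
        have h2 := integral_add iS iD
        simp only [Pi.add_apply] at h1
        rw [h1, h2]
    _ ≤ ε / 3 + ε / 3 + ε / 3 := by
        gcongr
        · exact hd S hS'
        · exact hN S T hS hT
        · exact hd T hT'
    _ = ε := by ring

end averages

section limitvar

set_option linter.unusedSectionVars false

variable {Ω : Type*} [MeasurableSpace Ω] {P : Measure Ω} [IsProbabilityMeasure P]
  {W : ℕ → Ω → ℝ}

lemma exch_memLp (hW : ∀ i, Measurable (W i)) (hex : Exchangeable P W)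
    (h2 : MemLp (W 0) 2 P) (i : ℕ) : MemLp (W i) 2 P :=
  (exch_one hW hex i).symm.memLp_snd h2

lemma exch_sq (hW : ∀ i, Measurable (W i)) (hex : Exchangeable P W) (i : ℕ) :
    ∫ ω, W i ω * W i ω ∂P = ∫ ω, W 0 ω ^ 2 ∂P := by
  have := ((exch_one hW hex i).comp (u := fun z => z * z) (by fun_prop)).integral_eq
  simp only [Function.comp_def] at this
  rw [this]
  simp only [sq]

lemma exch_mul (hW : ∀ i, Measurable (W i)) (hex : Exchangeable P W) (i j : ℕ) (hij : i ≠ j) :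
    ∫ ω, W i ω * W j ω ∂P = ∫ ω, W 0 ω * W 1 ω ∂P :=
  ((exch_two hW hex hij).comp (u := fun z : ℝ × ℝ => z.1 * z.2) (by fun_prop)).integral_eq

lemma integrable_evar (hW : ∀ i, Measurable (W i)) (hex : Exchangeable P W)
    (h2 : MemLp (W 0) 2 P) (S : Finset ℕ) :
    Integrable (fun ω => evar S (fun i => W i ω)) P := by
  unfold evar
  exact (integrable_avg S (fun i ω => W i ω ^ 2) fun i => (exch_memLp hW hex h2 i).integrable_sq).sub
    (memLp_avg S W (exch_memLp hW hex h2)).integrable_sq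

lemma evar_l1 (hW : ∀ i, Measurable (W i)) (hex : Exchangeable P W)
    (h2 : MemLp (W 0) 2 P) {ε : ℝ} (hε : 0 < ε) :
    ∃ N : ℕ, 0 < N ∧ ∀ S T : Finset ℕ, N ≤ S.card → N ≤ T.card →
      ∫ ω, |evar S (fun i => W i ω) - evar T (fun i => W i ω)| ∂P ≤ ε := by
  set a := ∫ ω, W 0 ω ^ 2 ∂P with ha
  set b := ∫ ω, W 0 ω * W 1 ω ∂P with hb
  have ha0 : 0 ≤ a := integral_nonneg fun ω => sq_nonneg _
  have hL2 := exch_memLp hW hex h2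
  obtain ⟨N1, hN10, hN1⟩ := avg_l1 hW hex (fun z => z ^ 2) (by fun_prop) h2.integrable_sq
    (ε := ε / 2) (by positivity)
  set δ : ℝ := ε / (16 * (a + 1)) with hδ
  have hδ0 : 0 < δ := by positivity
  obtain ⟨N2, hN20, hN2⟩ := avg_l2_small W hL2 a b (exch_sq hW hex) (exch_mul hW hex)
    (ε := δ * (ε / 4)) (by positivity)
  refine ⟨max N1 N2, by omega, fun S T hS hT => ?_⟩
  have hS' : S.Nonempty := Finset.card_pos.1 (by omega)
  have hT' : T.Nonempty := Finset.card_pos.1 (by omega)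
  have hsqi : ∀ i, Integrable (fun ω => W i ω ^ 2) P := fun i => (hL2 i).integrable_sq
  have hsqv : ∀ i, ∫ ω, W i ω ^ 2 ∂P = a := fun i => by
    rw [ha, ← exch_sq hW hex i]; simp only [sq]
  have iQS := integrable_avg S _ hsqi
  have iQT := integrable_avg T _ hsqi
  have vQS := integral_avg hS' _ hsqi a hsqv
  have vQT := integral_avg hT' _ hsqi a hsqv
  have mD : MemLp (fun ω => avg S (fun i => W i ω) - avg T (fun i => W i ω)) 2 P :=
    (memLp_avg S W hL2).sub (memLp_avg T W hL2)
  have iD2 := mD.integrable_sq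
  have iDQ : Integrable (fun ω => |avg S (fun i => W i ω ^ 2) - avg T (fun i => W i ω ^ 2)|) P :=
    (iQS.sub iQT).abs
  have hpt : ∀ ω, |evar S (fun i => W i ω) - evar T (fun i => W i ω)|
      ≤ |avg S (fun i => W i ω ^ 2) - avg T (fun i => W i ω ^ 2)|
        + ((avg S (fun i => W i ω) - avg T (fun i => W i ω)) ^ 2 / δ
        + 2 * δ * (avg S (fun i => W i ω ^ 2) + avg T (fun i => W i ω ^ 2))) := by
    intro ω
    have vS := evar_nonneg hS' (fun i => W i ω)
    have vT := evar_nonneg hT' (fun i => W i ω)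
    unfold evar at vS vT ⊢
    set qS := avg S (fun i => W i ω ^ 2)
    set qT := avg T (fun i => W i ω ^ 2)
    set x := avg S (fun i => W i ω)
    set y := avg T (fun i => W i ω)
    have h1 : |qS - x ^ 2 - (qT - y ^ 2)| ≤ |qS - qT| + |x ^ 2 - y ^ 2| := by
      have e : qS - x ^ 2 - (qT - y ^ 2) = (qS - qT) - (x ^ 2 - y ^ 2) := by ring
      rw [e]
      exact abs_sub _ _
    have h2 : |x ^ 2 - y ^ 2| ≤ (x - y) ^ 2 / δ + δ * (x + y) ^ 2 := by
      have e : x ^ 2 - y ^ 2 = (x - y) * (x + y) := by ring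
      rw [e, abs_mul, ← sq_abs (x - y), ← sq_abs (x + y)]
      have n1 := abs_nonneg (x - y)
      have n2 := abs_nonneg (x + y)
      rw [div_add' _ _ _ hδ0.ne', le_div_iff₀ hδ0]
      nlinarith [sq_nonneg (|x - y| - δ * |x + y|), mul_nonneg (mul_nonneg n1 n2) hδ0.le]
    have h3 : δ * (x + y) ^ 2 ≤ δ * (2 * (qS + qT)) := by
      gcongr
      nlinarith [sq_nonneg (x - y)]
    linarith
  calc _ ≤ ∫ ω, (|avg S (fun i => W i ω ^ 2) - avg T (fun i => W i ω ^ 2)|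
        + ((avg S (fun i => W i ω) - avg T (fun i => W i ω)) ^ 2 / δ
        + 2 * δ * (avg S (fun i => W i ω ^ 2) + avg T (fun i => W i ω ^ 2)))) ∂P :=
        integral_mono ((integrable_evar hW hex h2 S).sub (integrable_evar hW hex h2 T)).abs
          (iDQ.add ((iD2.div_const _).add ((iQS.add iQT).const_mul _))) hpt
    _ = (∫ ω, |avg S (fun i => W i ω ^ 2) - avg T (fun i => W i ω ^ 2)| ∂P)
        + ((∫ ω, (avg S (fun i => W i ω) - avg T (fun i => W i ω)) ^ 2 ∂P) / δ
        + 2 * δ * (a + a)) := by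
        have h1 := integral_add iDQ ((iD2.div_const δ).add ((iQS.add iQT).const_mul (2 * δ)))
        have h2 := integral_add (iD2.div_const δ) ((iQS.add iQT).const_mul (2 * δ))
        have h3 := integral_add iQS iQT
        simp only [Pi.add_apply] at h1 h2 h3
        rw [h1, h2, integral_const_mul, h3, vQS, vQT, integral_div]
    _ ≤ ε / 2 + ((δ * (ε / 4)) / δ + 2 * δ * (a + a)) := by
        gcongr
        · exact hN1 S T (by omega) (by omega)
        · exact hN2 S T (by omega) (by omega)
    _ ≤ ε := by
        have e1 : (δ * (ε / 4)) / δ = ε / 4 := by field_simp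
        have e2 : δ * (16 * (a + 1)) = ε := by rw [hδ]; field_simp
        rw [e1]
        nlinarith

lemma integral_evar (hW : ∀ i, Measurable (W i)) (hex : Exchangeable P W)
    (h2 : MemLp (W 0) 2 P) {S : Finset ℕ} (hS : S.Nonempty) :
    ∫ ω, evar S (fun i => W i ω) ∂P
      = (1 - 1 / (S.card : ℝ)) * ((∫ ω, W 0 ω ^ 2 ∂P) - ∫ ω, W 0 ω * W 1 ω ∂P) := by
  have hL2 := exch_memLp hW hex h2
  have hsqi : ∀ i, Integrable (fun ω => W i ω ^ 2) P := fun i => (hL2 i).integrable_sq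
  have hsqv : ∀ i, ∫ ω, W i ω ^ 2 ∂P = ∫ ω, W 0 ω ^ 2 ∂P := fun i => by
    rw [← exch_sq hW hex i]; simp only [sq]
  have hc : (S.card : ℝ) ≠ 0 := by simpa using hS.ne_empty
  have h := sq_moment S W hL2 _ _ (exch_sq hW hex) (exch_mul hW hex) (fun _ => (S.card : ℝ)⁻¹)
  have e : ∀ ω, ∑ i ∈ S, (S.card : ℝ)⁻¹ * W i ω = avg S (fun i => W i ω) := by
    intro ω
    unfold avg
    rw [← Finset.mul_sum]; ring
  simp only [e] at h
  unfold evar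
  rw [integral_sub (integrable_avg S _ hsqi) (memLp_avg S W hL2).integrable_sq,
    integral_avg hS _ hsqi _ hsqv, h]
  simp only [Finset.sum_const, nsmul_eq_mul]
  field_simp
  ring

/-- The limiting random variance. -/
lemma exists_limit_var (hW : ∀ i, Measurable (W i)) (hex : Exchangeable P W)
    (h2 : MemLp (W 0) 2 P) :
    ∃ V : Ω → ℝ, Measurable V ∧ (∀ ω, 0 ≤ V ω) ∧ Integrable V P ∧
      ∫ ω, V ω ∂P = (∫ ω, W 0 ω ^ 2 ∂P) - ∫ ω, W 0 ω * W 1 ω ∂P ∧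
      ∀ ε > 0, ∃ N : ℕ, 0 < N ∧ ∀ S : Finset ℕ, N ≤ S.card →
        ∫ ω, |evar S (fun i => W i ω) - V ω| ∂P ≤ ε := by
  have hi := integrable_evar hW hex h2
  set f : ℕ → (Ω →₁[P] ℝ) := fun n => (hi (Finset.range n)).toL1 _ with hf
  have hdist : ∀ n k, dist (f n) (f k)
      = ∫ ω, |evar (Finset.range n) (fun i => W i ω) - evar (Finset.range k) (fun i => W i ω)| ∂P := by
    intro n k
    rw [dist_eq_norm, hf]
    simp only
    rw [← Integrable.toL1_sub, L1.norm_of_fun_eq_integral_norm]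
    rfl
  have hcau : CauchySeq f := by
    rw [Metric.cauchySeq_iff]
    intro ε hε
    obtain ⟨N, -, hN⟩ := evar_l1 hW hex h2 (ε := ε / 2) (by positivity)
    refine ⟨N, fun n hn k hk => ?_⟩
    rw [hdist]
    exact (hN _ _ (by simpa using hn) (by simpa using hk)).trans_lt (by linarith)
  obtain ⟨L, hL⟩ := cauchySeq_tendsto_of_complete hcau
  have hLi := L1.integrable_coeFn L
  have hdist2 : ∀ n, dist (f n) L
      = ∫ ω, |evar (Finset.range n) (fun i => W i ω) - L ω| ∂P := by
    intro n
    rw [dist_eq_norm, hf]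
    simp only
    conv_lhs => rw [← Integrable.toL1_coeFn L hLi]
    rw [← Integrable.toL1_sub, L1.norm_of_fun_eq_integral_norm]
    rfl
  have hLm := hLi.aestronglyMeasurable.aemeasurable
  set V : Ω → ℝ := fun ω => max 0 (hLm.mk L ω) with hV
  have hVm : Measurable V := measurable_const.max hLm.measurable_mk
  have hVa : ∀ᵐ ω ∂P, V ω = max 0 (L ω) := by
    filter_upwards [hLm.ae_eq_mk] with ω h
    simp only [hV, ← h]
  have hVi : Integrable V P := by
    have : Integrable (fun ω => max 0 (L ω)) P := (integrable_zero _ _ _).sup hLi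
    exact this.congr (by filter_upwards [hVa] with ω h using h.symm)
  have hmain : ∀ ε > 0, ∃ N : ℕ, 0 < N ∧ ∀ S : Finset ℕ, N ≤ S.card →
        ∫ ω, |evar S (fun i => W i ω) - V ω| ∂P ≤ ε := by
    intro ε hε
    obtain ⟨N, hN0, hN⟩ := evar_l1 hW hex h2 (ε := ε / 2) (by positivity)
    refine ⟨N, hN0, fun S hS => ?_⟩
    have hS' : S.Nonempty := Finset.card_pos.1 (by omega)
    obtain ⟨n, hn1, hn2⟩ := ((tendsto_iff_dist_tendsto_zero.1 hL).eventually_lt_const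
      (by positivity : (0 : ℝ) < ε / 2) |>.and (eventually_ge_atTop N)).exists
    rw [hdist2] at hn1
    have i1 : Integrable (fun ω => |evar S (fun i => W i ω)
      - evar (Finset.range n) (fun i => W i ω)|) P := ((hi S).sub (hi _)).abs
    have i2 : Integrable (fun ω => |evar (Finset.range n) (fun i => W i ω) - L ω|) P :=
      ((hi _).sub hLi).abs
    calc _ ≤ ∫ ω, (|evar S (fun i => W i ω) - evar (Finset.range n) (fun i => W i ω)|
          + |evar (Finset.range n) (fun i => W i ω) - L ω|) ∂P := by
          apply integral_mono_ae ((hi S).sub hVi).abs (i1.add i2)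
          filter_upwards [hVa] with ω h
          simp only [Pi.sub_apply, Pi.add_apply]
          rw [h]
          have h1 := evar_nonneg hS' (fun i => W i ω)
          refine le_trans ?_ (abs_sub_le _ _ _)
          have := abs_max_sub_max_le_abs (evar S (fun i => W i ω)) (L ω) 0
          rw [max_eq_left h1, max_comm] at this
          exact this
      _ = _ := integral_add i1 i2
      _ ≤ ε / 2 + ε / 2 := by
          gcongr
          exact hN _ _ hS (by simpa using hn2)
      _ = ε := by ring
  refine ⟨V, hVm, fun ω => le_max_left _ _, hVi, ?_, hmain⟩
  -- value of the integral
  have t1 : Tendsto (fun n : ℕ => ∫ ω, evar (Finset.range n) (fun i => W i ω) ∂P) atTop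
      (nhds (∫ ω, V ω ∂P)) := by
    rw [Metric.tendsto_atTop]
    intro ε hε
    obtain ⟨N, -, hN⟩ := hmain (ε / 2) (by positivity)
    refine ⟨N, fun n hn => ?_⟩
    rw [Real.dist_eq, ← integral_sub (hi _) hVi]
    refine (abs_integral_le_integral_abs).trans_lt ?_
    exact (hN (Finset.range n) (by simpa using hn)).trans_lt (by linarith)
  have t2 : Tendsto (fun n : ℕ => ∫ ω, evar (Finset.range n) (fun i => W i ω) ∂P) atTop
      (nhds ((1 - 0) * ((∫ ω, W 0 ω ^ 2 ∂P) - ∫ ω, W 0 ω * W 1 ω ∂P))) := by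
    have : Tendsto (fun n : ℕ => (1 - 1 / (n : ℝ)) *
        ((∫ ω, W 0 ω ^ 2 ∂P) - ∫ ω, W 0 ω * W 1 ω ∂P)) atTop
        (nhds ((1 - 0) * ((∫ ω, W 0 ω ^ 2 ∂P) - ∫ ω, W 0 ω * W 1 ω ∂P))) :=
      (tendsto_const_nhds.sub tendsto_one_div_atTop_nhds_zero_nat).mul_const _
    refine this.congr' ?_
    filter_upwards [eventually_gt_atTop 0] with n hn
    rw [integral_evar hW hex h2 (by simpa using hn.ne')]
    simp
  have := tendsto_nhds_unique t1 t2
  rw [this]; ring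

end limitvar

lemma prod_sub_prod_norm {ι : Type*} (s : Finset ι) (a b : ι → ℂ) (ha : ∀ i, ‖a i‖ ≤ 1)
    (hb : ∀ i, ‖b i‖ ≤ 1) : ‖∏ i ∈ s, a i - ∏ i ∈ s, b i‖ ≤ ∑ i ∈ s, ‖a i - b i‖ := by
  classical
  induction s using Finset.induction_on with
  | empty => simp
  | insert i s hi ih =>
    rw [Finset.prod_insert hi, Finset.prod_insert hi, Finset.sum_insert hi]
    have e : a i * ∏ i ∈ s, a i - b i * ∏ i ∈ s, b i
        = (a i - b i) * ∏ i ∈ s, a i + b i * (∏ i ∈ s, a i - ∏ i ∈ s, b i) := by ring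
    rw [e]
    refine (norm_add_le _ _).trans ?_
    rw [norm_mul, norm_mul]
    have h1 : ‖∏ i ∈ s, a i‖ ≤ 1 := by
      rw [norm_prod]
      exact Finset.prod_le_one (fun _ _ => norm_nonneg _) (fun i _ => ha i)
    have h2 := mul_le_mul_of_nonneg_left h1 (norm_nonneg (a i - b i))
    have h3 := mul_le_mul_of_nonneg_right (hb i)
      (norm_nonneg (∏ i ∈ s, a i - ∏ i ∈ s, b i))
    linarith

lemma exp_neg_lip {s t : ℝ} (hs : 0 ≤ s) (ht : 0 ≤ t) :
    |Real.exp (-s) - Real.exp (-t)| ≤ |s - t| := by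
  wlog h : s ≤ t generalizing s t with H
  · rw [abs_sub_comm, abs_sub_comm s]
    exact H ht hs (le_of_not_ge h)
  have h1 : Real.exp (-t) ≤ Real.exp (-s) := Real.exp_le_exp.2 (by linarith)
  rw [abs_of_nonneg (by linarith), abs_of_nonpos (by linarith)]
  have h2 : Real.exp (-t) = Real.exp (-s) * Real.exp (s - t) := by
    rw [← Real.exp_add]; congr 1; ring
  have h3 := Real.add_one_le_exp (s - t)
  have h4 : Real.exp (-s) ≤ 1 := by simpa using hs
  have h5 := Real.exp_pos (-s)
  rw [h2]
  nlinarith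

lemma cexp_diff (u : ℝ) {s t : ℝ} (hs : 0 ≤ s) (ht : 0 ≤ t) :
    ‖Complex.exp (Complex.I * (u : ℝ) - (s : ℝ)) - Complex.exp (-(t : ℝ))‖ ≤ |u| + |s - t| := by
  have e : Complex.exp (Complex.I * (u : ℝ) - (s : ℝ)) - Complex.exp (-(t : ℝ))
      = ((Real.exp (-s) : ℝ) : ℂ) * (Complex.exp (Complex.I * u) - 1)
        + ((Real.exp (-s) - Real.exp (-t) : ℝ) : ℂ) := by
    push_cast
    rw [mul_sub, ← Complex.exp_add]
    ring_nf
  rw [e]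
  refine (norm_add_le _ _).trans ?_
  rw [norm_mul, Complex.norm_real, Complex.norm_real, Real.norm_eq_abs, Real.norm_eq_abs]
  have h1 : |Real.exp (-s)| ≤ 1 := by
    rw [abs_of_pos (Real.exp_pos _)]; simpa using hs
  have h2 : ‖Complex.exp (Complex.I * u) - 1‖ ≤ |u| := Real.norm_exp_I_mul_ofReal_sub_one_le
  have h3 := exp_neg_lip hs ht
  have := mul_le_mul h1 h2 (norm_nonneg _) zero_le_one
  linarith

lemma pair_inj (j : ℕ) : Function.Injective (Nat.pair j) :=
  fun _ _ h => (Nat.pair_eq_pair.1 h).2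

def row (j n : ℕ) : Finset ℕ :=
  (Finset.range n).map ⟨Nat.pair j, pair_inj j⟩

lemma card_row (j n : ℕ) : (row j n).card = n := by simp [row]

lemma unpair_of_mem_row {i j n : ℕ} (h : i ∈ row j n) : i.unpair.1 = j := by
  obtain ⟨k, -, rfl⟩ := Finset.mem_map.1 h
  change (Nat.unpair (Nat.pair j k)).1 = j
  rw [Nat.unpair_pair]

section char

variable {Ω : Type*} [MeasurableSpace Ω] {P : Measure Ω} [IsProbabilityMeasure P]
  {W : ℕ → Ω → ℝ}

lemma integrable_cexp {f : Ω → ℝ} (hf : Measurable f) :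
    Integrable (fun ω => Complex.exp (Complex.I * (f ω : ℝ))) P := by
  refine Integrable.of_bound (Measurable.aestronglyMeasurable (by fun_prop)) 1
    (Eventually.of_forall fun ω => ?_)
  rw [Complex.norm_exp_I_mul_ofReal]

lemma prod_rows (hW : ∀ i, Measurable (W i)) (hex : Exchangeable P W) {m : ℕ} (z : Fin m → ℝ)
    {n : ℕ} (hn : 0 < n) :
    ∫ ω, ∏ j : Fin m, ((∑ i ∈ row j n, Complex.exp (Complex.I * (z j * W i ω : ℝ)))
        / ((row j n).card : ℂ)) ∂P
      = ∫ ω, Complex.exp (Complex.I * (∑ j : Fin m, z j * W j ω : ℝ)) ∂P := by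
  have e1 : ∀ ω, ∏ j : Fin m, ((∑ i ∈ row j n, Complex.exp (Complex.I * (z j * W i ω : ℝ)))
        / ((row j n).card : ℂ))
      = (∑ τ ∈ Fintype.piFinset (fun j : Fin m => row j n),
        Complex.exp (Complex.I * (∑ j : Fin m, z j * W (τ j) ω : ℝ))) / (n : ℂ) ^ m := by
    intro ω
    simp only [card_row]
    rw [Finset.prod_div_distrib, Finset.prod_univ_sum]
    simp only [Finset.prod_const, Finset.card_univ, Fintype.card_fin]
    congr 1
    refine Finset.sum_congr rfl fun τ _ => ?_
    rw [← Complex.exp_sum, ← Finset.mul_sum]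
    push_cast
    rfl
  simp_rw [e1]
  rw [integral_div, integral_finsetSum _ (fun τ _ => integrable_cexp (by fun_prop))]
  have e2 : ∀ τ ∈ Fintype.piFinset (fun j : Fin m => row j n),
      ∫ ω, Complex.exp (Complex.I * (∑ j : Fin m, z j * W (τ j) ω : ℝ)) ∂P
      = ∫ ω, Complex.exp (Complex.I * (∑ j : Fin m, z j * W j ω : ℝ)) ∂P := by
    intro τ hτ
    rw [Fintype.mem_piFinset] at hτ
    have hinj : Function.Injective τ := by
      intro i j h
      have h1 := unpair_of_mem_row (hτ i)
      have h2 := unpair_of_mem_row (hτ j)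
      rw [h, h2] at h1
      exact (Fin.ext h1).symm
    exact ((exch_ident hW hex τ hinj).comp
      (u := fun w => Complex.exp (Complex.I * (∑ j : Fin m, z j * w j : ℝ)))
      (by fun_prop)).integral_eq
  rw [Finset.sum_congr rfl e2, Finset.sum_const, Fintype.card_piFinset]
  simp only [card_row, Finset.prod_const, Finset.card_univ, Fintype.card_fin, nsmul_eq_mul]
  have : (n : ℂ) ≠ 0 := by exact_mod_cast hn.ne'
  push_cast
  field_simp

/-- Quantitative comparison of characteristic functions. -/
lemma char_bound (hW : ∀ i, Measurable (W i)) (hex : Exchangeable P W)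
    (h2 : MemLp (W 0) 2 P) (h3 : Integrable (fun ω => |W 0 ω| ^ 3) P) (V : Ω → ℝ)
    (hVm : Measurable V) (hV0 : ∀ ω, 0 ≤ V ω) (hVi : Integrable V P)
    (hV : ∀ ε > 0, ∃ N : ℕ, 0 < N ∧ ∀ S : Finset ℕ, N ≤ S.card →
        ∫ ω, |evar S (fun i => W i ω) - V ω| ∂P ≤ ε) {m : ℕ} (z : Fin m → ℝ) :
    ‖(∫ ω, Complex.exp (Complex.I * (∑ j : Fin m, z j * W j ω : ℝ)) ∂P)
      - ∫ ω, Complex.exp (-((∑ j, z j ^ 2) * V ω / 2 : ℝ)) ∂P‖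
      ≤ 33 * (∫ ω, |W 0 ω| ^ 3 ∂P) * (∑ j, |z j| ^ 3)
        + |∑ j, z j| * ∫ ω, |W 0 ω| ∂P := by
  have h1 : Integrable (W 0) P := h2.integrable (by norm_num)
  apply le_of_forall_pos_le_add
  intro η hη
  set K : ℝ := ∑ j, (|z j| + z j ^ 2 / 2) with hK
  have hK0 : 0 ≤ K := Finset.sum_nonneg fun j _ => by positivity
  obtain ⟨ε, hε, hεK⟩ : ∃ ε : ℝ, 0 < ε ∧ ε * K ≤ η := by
    refine ⟨η / (K + 1), by positivity, ?_⟩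
    rw [div_mul_eq_mul_div, div_le_iff₀ (by positivity)]
    nlinarith
  obtain ⟨N1, hN10, hN1⟩ := avg_l1 hW hex (fun w => w) (by fun_prop) h1 hε
  obtain ⟨N2, hN20, hN2⟩ := hV ε hε
  set n := max N1 N2 with hn
  have hn0 : 0 < n := by omega
  have hne : ∀ j, (row j n).Nonempty := fun j => Finset.card_pos.1 (by rw [card_row]; exact hn0)
  have hi1 : ∀ i, Integrable (W i) P := fun i => (exch_memLp hW hex h2 i).integrable (by norm_num)
  have hi3 : ∀ i, Integrable (fun ω => |W i ω| ^ 3) P := fun i =>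
    (((exch_one hW hex i).comp (u := fun w => |w| ^ 3) (by fun_prop)).integrable_iff).2 h3
  have hv3 : ∀ i, ∫ ω, |W i ω| ^ 3 ∂P = ∫ ω, |W 0 ω| ^ 3 ∂P := fun i =>
    ((exch_one hW hex i).comp (u := fun w => |w| ^ 3) (by fun_prop)).integral_eq
  have hv1 : ∀ i, ∫ ω, |W i ω| ∂P = ∫ ω, |W 0 ω| ∂P := fun i =>
    ((exch_one hW hex i).comp (u := fun w => |w|) (by fun_prop)).integral_eq
  rw [← prod_rows hW hex z hn0]
  set F : Ω → ℂ := fun ω => ∏ j : Fin m,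
    ((∑ i ∈ row j n, Complex.exp (Complex.I * (z j * W i ω : ℝ))) / ((row j n).card : ℂ)) with hF
  set G : Ω → ℂ := fun ω => Complex.exp (-((∑ j, z j ^ 2) * V ω / 2 : ℝ)) with hG
  have hfac : ∀ (j : Fin m) ω, ‖(∑ i ∈ row j n, Complex.exp (Complex.I * (z j * W i ω : ℝ)))
      / ((row j n).card : ℂ)‖ ≤ 1 := by
    intro j ω
    rw [norm_div, card_row]
    have : ‖∑ i ∈ row j n, Complex.exp (Complex.I * (z j * W i ω : ℝ))‖ ≤ n := by
      refine (norm_sum_le _ _).trans ?_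
      simp only [Complex.norm_exp_I_mul_ofReal]
      simp [card_row]
    rw [Complex.norm_natCast]
    exact div_le_one_of_le₀ this (Nat.cast_nonneg _)
  have hGn : ∀ ω, ‖G ω‖ ≤ 1 := by
    intro ω
    simp only [hG]
    rw [← Complex.ofReal_neg, Complex.norm_exp_ofReal]
    have := hV0 ω
    have : 0 ≤ ∑ j, z j ^ 2 := Finset.sum_nonneg fun j _ => sq_nonneg _
    rw [Real.exp_le_one_iff]
    have : 0 ≤ (∑ j, z j ^ 2) * V ω / 2 := by positivity
    linarith
  have hFi : Integrable F P := by
    refine Integrable.of_bound (Measurable.aestronglyMeasurable ?_) 1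
      (Eventually.of_forall fun ω => ?_)
    · simp only [hF]
      fun_prop
    · simp only [hF]
      rw [norm_prod]
      exact Finset.prod_le_one (fun _ _ => norm_nonneg _) (fun j _ => hfac j ω)
  have hGi : Integrable G P := by
    refine Integrable.of_bound (Measurable.aestronglyMeasurable ?_) 1
      (Eventually.of_forall hGn)
    simp only [hG]
    fun_prop
  set M : ℕ → Ω → ℝ := fun j ω => avg (row j n) (fun i => W i ω) with hM
  set U : ℕ → Ω → ℝ := fun j ω => evar (row j n) (fun i => W i ω) with hU
  set B : ℕ → Ω → ℝ := fun j ω => avg (row j n) (fun i => |W i ω| ^ 3) with hB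
  have hpt : ∀ ω, ‖F ω - G ω‖ ≤ (∑ j : Fin m, 33 * |z j| ^ 3 * B j ω)
      + ((∑ j : Fin m, |z j| * |M j ω - M 0 ω|) + |∑ j, z j| * |M 0 ω|
      + ∑ j : Fin m, z j ^ 2 / 2 * |U j ω - V ω|) := by
    intro ω
    have hU0 : ∀ j, 0 ≤ U j ω := fun j => evar_nonneg (hne j) _
    set H : ℂ := ∏ j : Fin m, Complex.exp (Complex.I * (z j * M j ω : ℝ)
      - (z j ^ 2 * U j ω / 2 : ℝ)) with hH
    have a1 : ‖F ω - H‖ ≤ ∑ j : Fin m, 33 * |z j| ^ 3 * B j ω := by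
      simp only [hF, hH]
      refine (prod_sub_prod_norm _ _ _ (fun j => hfac j ω) ?_).trans ?_
      · intro j
        rw [Complex.norm_exp]
        rw [Real.exp_le_one_iff]
        have : 0 ≤ z j ^ 2 * U j ω / 2 := by have := hU0 j; positivity
        simp only [Complex.sub_re, Complex.mul_re, Complex.I_re, Complex.ofReal_re, Complex.I_im,
          Complex.ofReal_im]
        linarith
      · exact Finset.sum_le_sum fun j _ => emp_char (hne j) (fun i => W i ω) (z j)
    have a2 : ‖H - G ω‖ ≤ |∑ j : Fin m, z j * M j ω|
        + |(∑ j : Fin m, z j ^ 2 * U j ω / 2) - (∑ j, z j ^ 2) * V ω / 2| := by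
      have : H = Complex.exp (Complex.I * (∑ j : Fin m, z j * M j ω : ℝ)
          - (∑ j : Fin m, z j ^ 2 * U j ω / 2 : ℝ)) := by
        rw [hH, ← Complex.exp_sum]
        congr 1
        push_cast
        rw [Finset.sum_sub_distrib, Finset.mul_sum]
      rw [this]
      apply cexp_diff
      · exact Finset.sum_nonneg fun j _ => by have := hU0 j; positivity
      · have := hV0 ω
        have : 0 ≤ ∑ j, z j ^ 2 := Finset.sum_nonneg fun j _ => sq_nonneg _
        positivity
    have a3 : |∑ j : Fin m, z j * M j ω|
        ≤ (∑ j : Fin m, |z j| * |M j ω - M 0 ω|) + |∑ j, z j| * |M 0 ω| := by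
      have e : ∑ j : Fin m, z j * M j ω
          = (∑ j : Fin m, z j * (M j ω - M 0 ω)) + (∑ j, z j) * M 0 ω := by
        rw [Finset.sum_mul, ← Finset.sum_add_distrib]
        exact Finset.sum_congr rfl fun j _ => by ring
      rw [e]
      refine (abs_add_le _ _).trans ?_
      rw [abs_mul]
      gcongr
      refine (Finset.abs_sum_le_sum_abs _ _).trans (le_of_eq ?_)
      exact Finset.sum_congr rfl fun j _ => abs_mul _ _
    have a4 : |(∑ j : Fin m, z j ^ 2 * U j ω / 2) - (∑ j, z j ^ 2) * V ω / 2|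
        ≤ ∑ j : Fin m, z j ^ 2 / 2 * |U j ω - V ω| := by
      have e : (∑ j : Fin m, z j ^ 2 * U j ω / 2) - (∑ j, z j ^ 2) * V ω / 2
          = ∑ j : Fin m, z j ^ 2 / 2 * (U j ω - V ω) := by
        rw [mul_div_assoc, Finset.sum_mul, ← Finset.sum_sub_distrib]
        exact Finset.sum_congr rfl fun j _ => by ring
      rw [e]
      refine (Finset.abs_sum_le_sum_abs _ _).trans (le_of_eq ?_)
      refine Finset.sum_congr rfl fun j _ => ?_
      rw [abs_mul, abs_of_nonneg (by positivity)]
    have := norm_sub_le_norm_sub_add_norm_sub (F ω) H (G ω)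
    linarith
  have iB : ∀ j, Integrable (B j) P := fun j => integrable_avg _ _ hi3
  have iM : ∀ j, Integrable (M j) P := fun j => integrable_avg _ _ hi1
  have iMd : ∀ j, Integrable (fun ω => |M j ω - M 0 ω|) P := fun j => ((iM j).sub (iM 0)).abs
  have iUd : ∀ j, Integrable (fun ω => |U j ω - V ω|) P := fun j =>
    ((integrable_evar hW hex h2 _).sub hVi).abs
  have I1 : Integrable (fun ω => ∑ j : Fin m, 33 * |z j| ^ 3 * B j ω) P :=
    integrable_finsetSum _ fun j _ => (iB j).const_mul _
  have I2 : Integrable (fun ω => ∑ j : Fin m, |z j| * |M j ω - M 0 ω|) P :=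
    integrable_finsetSum _ fun j _ => (iMd j).const_mul _
  have I3 : Integrable (fun ω => |∑ j, z j| * |M 0 ω|) P := (iM 0).abs.const_mul _
  have I4 : Integrable (fun ω => ∑ j : Fin m, z j ^ 2 / 2 * |U j ω - V ω|) P :=
    integrable_finsetSum _ fun j _ => (iUd j).const_mul _
  have J1 : ∫ ω, ∑ j : Fin m, 33 * |z j| ^ 3 * B j ω ∂P
      = 33 * (∫ ω, |W 0 ω| ^ 3 ∂P) * (∑ j, |z j| ^ 3) := by
    rw [integral_finsetSum _ fun (j : Fin m) _ => (iB (j : ℕ)).const_mul (33 * |z j| ^ 3), Finset.mul_sum]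
    refine Finset.sum_congr rfl fun j _ => ?_
    rw [integral_const_mul, hB]
    simp only
    rw [integral_avg (hne j) _ hi3 _ hv3]
    ring
  have J2 : ∫ ω, ∑ j : Fin m, |z j| * |M j ω - M 0 ω| ∂P ≤ ε * ∑ j, |z j| := by
    rw [integral_finsetSum _ fun (j : Fin m) _ => (iMd (j : ℕ)).const_mul |z j|, Finset.mul_sum]
    refine Finset.sum_le_sum fun j _ => ?_
    rw [integral_const_mul, mul_comm]
    refine mul_le_mul_of_nonneg_right ?_ (by positivity)
    exact hN1 _ _ (by rw [card_row]; omega) (by rw [card_row]; omega)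
  have J3 : ∫ ω, |∑ j, z j| * |M 0 ω| ∂P ≤ |∑ j, z j| * ∫ ω, |W 0 ω| ∂P := by
    rw [integral_const_mul]
    refine mul_le_mul_of_nonneg_left ?_ (abs_nonneg _)
    rw [← integral_avg (hne 0) (fun i ω => |W i ω|) (fun i => (hi1 i).abs) _ hv1]
    apply integral_mono (iM 0).abs (integrable_avg _ _ fun i => (hi1 i).abs)
    intro ω
    exact abs_avg_le _ _
  have J4 : ∫ ω, ∑ j : Fin m, z j ^ 2 / 2 * |U j ω - V ω| ∂P ≤ ε * ∑ j, z j ^ 2 / 2 := by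
    rw [integral_finsetSum _ fun (j : Fin m) _ => (iUd (j : ℕ)).const_mul (z j ^ 2 / 2), Finset.mul_sum]
    refine Finset.sum_le_sum fun j _ => ?_
    rw [integral_const_mul, mul_comm]
    refine mul_le_mul_of_nonneg_right ?_ (by positivity)
    exact hN2 _ (by rw [card_row]; omega)
  have hsum : ∫ ω, ((∑ j : Fin m, 33 * |z j| ^ 3 * B j ω)
      + ((∑ j : Fin m, |z j| * |M j ω - M 0 ω|) + |∑ j, z j| * |M 0 ω|
      + ∑ j : Fin m, z j ^ 2 / 2 * |U j ω - V ω|)) ∂P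
      = (∫ ω, ∑ j : Fin m, 33 * |z j| ^ 3 * B j ω ∂P)
      + ((∫ ω, ∑ j : Fin m, |z j| * |M j ω - M 0 ω| ∂P) + (∫ ω, |∑ j, z j| * |M 0 ω| ∂P)
      + ∫ ω, ∑ j : Fin m, z j ^ 2 / 2 * |U j ω - V ω| ∂P) := by
    have k1 := integral_add I1 ((I2.add I3).add I4)
    have k2 := integral_add (I2.add I3) I4
    have k3 := integral_add I2 I3
    simp only [Pi.add_apply] at k1 k2 k3
    rw [k1, k2, k3]
  have hKK : ε * K = ε * ∑ j, |z j| + ε * ∑ j, z j ^ 2 / 2 := by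
    rw [hK, Finset.sum_add_distrib, mul_add]
  calc _ = ‖∫ ω, (F ω - G ω) ∂P‖ := by rw [integral_sub hFi hGi]
    _ ≤ ∫ ω, ‖F ω - G ω‖ ∂P := norm_integral_le_integral_norm _
    _ ≤ _ := integral_mono (hFi.sub hGi).norm (I1.add ((I2.add I3).add I4)) hpt
    _ = _ := hsum
    _ ≤ _ := by rw [J1]; linarith

end char

lemma relu_nonneg (z : ℝ) : 0 ≤ relu z := le_max_left _ _

lemma relu_mul {r : ℝ} (hr : 0 ≤ r) (z : ℝ) : relu (r * z) = r * relu z := by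
  unfold relu
  rw [mul_max_of_nonneg _ _ hr, mul_zero]

lemma relu_of_nonneg {z : ℝ} (hz : 0 ≤ z) : relu z = z := max_eq_right hz

lemma relu_of_nonpos {z : ℝ} (hz : z ≤ 0) : relu z = 0 := max_eq_left hz

lemma continuous_relu : Continuous relu := continuous_const.max continuous_id

lemma relu_le_abs (z : ℝ) : relu z ≤ |z| := max_le (abs_nonneg _) (le_abs_self _)

lemma angular (θ : ℝ) (hθ : θ ∈ Set.Icc 0 Real.pi) :
    ∫ φ in Set.Ioo (-Real.pi) Real.pi, relu (Real.cos φ) * relu (Real.cos (φ - θ))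
      = (Real.sin θ + (Real.pi - θ) * Real.cos θ) / 2 := by
  obtain ⟨h0, h1⟩ := hθ
  have hpi := Real.pi_pos
  have e : ∀ φ ∈ Set.Ioo (-Real.pi) Real.pi, relu (Real.cos φ) * relu (Real.cos (φ - θ))
      = (Set.Ioc (θ - Real.pi / 2) (Real.pi / 2)).indicator
        (fun φ => Real.cos φ * Real.cos (φ - θ)) φ := by
    rintro φ ⟨h2, h3⟩
    by_cases h : φ ∈ Set.Ioc (θ - Real.pi / 2) (Real.pi / 2)
    · rw [Set.indicator_of_mem h]
      obtain ⟨h4, h5⟩ := h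
      rw [relu_of_nonneg (Real.cos_nonneg_of_neg_pi_div_two_le_of_le (by linarith) h5),
        relu_of_nonneg (Real.cos_nonneg_of_neg_pi_div_two_le_of_le (by linarith) (by linarith))]
    · rw [Set.indicator_of_notMem h]
      rw [Set.mem_Ioc, not_and_or, not_lt, not_le] at h
      by_cases h6 : Real.cos φ ≤ 0
      · rw [relu_of_nonpos h6, zero_mul]
      have h7 : φ < Real.pi / 2 := by
        by_contra hc
        exact h6 (Real.cos_nonpos_of_pi_div_two_le_of_le (by linarith) (by linarith))
      have h8 : -(Real.pi / 2) < φ := by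
        by_contra hc
        rw [← Real.cos_neg] at h6
        exact h6 (Real.cos_nonpos_of_pi_div_two_le_of_le (by linarith) (by linarith))
      have h9 : φ ≤ θ - Real.pi / 2 := by rcases h with h | h <;> linarith
      rw [relu_of_nonpos (z := Real.cos (φ - θ)), mul_zero]
      rw [← Real.cos_neg]
      exact Real.cos_nonpos_of_pi_div_two_le_of_le (by linarith) (by linarith)
  rw [setIntegral_congr_fun measurableSet_Ioo e, setIntegral_indicator measurableSet_Ioc]
  have e2 : Set.Ioo (-Real.pi) Real.pi ∩ Set.Ioc (θ - Real.pi / 2) (Real.pi / 2)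
      = Set.Ioc (θ - Real.pi / 2) (Real.pi / 2) := by
    apply Set.inter_eq_right.2
    rintro φ ⟨h2, h3⟩
    constructor <;> linarith
  rw [e2, ← intervalIntegral.integral_of_le (by linarith)]
  have hd : ∀ φ ∈ Set.uIcc (θ - Real.pi / 2) (Real.pi / 2),
      HasDerivAt (fun φ => Real.sin (2 * φ - θ) / 4 + φ * Real.cos θ / 2)
        (Real.cos φ * Real.cos (φ - θ)) φ := by
    intro φ _
    have k1 : HasDerivAt (fun φ : ℝ => 2 * φ - θ) 2 φ := by
      simpa using ((hasDerivAt_id φ).const_mul 2).sub_const θ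
    have k2 := ((k1.sin.div_const 4).add (((hasDerivAt_id φ).mul_const (Real.cos θ)).div_const 2))
    refine k2.congr_deriv ?_
    have e3 : 2 * φ - θ = φ + (φ - θ) := by ring
    have e4 : Real.cos θ = Real.cos (φ - (φ - θ)) := by congr 1; ring
    rw [e3, e4, Real.cos_add, Real.cos_sub φ (φ - θ)]
    ring
  rw [intervalIntegral.integral_eq_sub_of_hasDerivAt hd
    (Continuous.intervalIntegrable (by fun_prop) _ _)]
  have e5 : 2 * (Real.pi / 2) - θ = Real.pi - θ := by ring
  have e6 : 2 * (θ - Real.pi / 2) - θ = -(Real.pi - θ) := by ring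
  rw [e5, e6, Real.sin_neg, Real.sin_pi_sub]
  ring

lemma radial : ∫ r in Set.Ioi (0 : ℝ), r ^ 3 * Real.exp (-r ^ 2 / 2) = 2 := by
  have := integral_rpow_mul_exp_neg_mul_rpow (p := 2) (q := 3) (b := 1 / 2)
    (by norm_num) (by norm_num) (by norm_num)
  have e : (3 + 1 : ℝ) / 2 = 1 + 1 := by norm_num
  rw [neg_div, e, Real.Gamma_add_one one_ne_zero, Real.Gamma_one] at this
  have e2 : (1 / 2 : ℝ) ^ (-(1 + 1) : ℝ) = 4 := by
    rw [Real.rpow_neg (by norm_num)]; norm_num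
  rw [e2] at this
  calc _ = ∫ x in Set.Ioi (0 : ℝ), x ^ (3 : ℝ) * Real.exp (-(1 / 2) * x ^ (2 : ℝ)) := by
        refine setIntegral_congr_fun measurableSet_Ioi fun r _ => ?_
        rw [show (3 : ℝ) = ((3 : ℕ) : ℝ) by norm_num, show (2 : ℝ) = ((2 : ℕ) : ℝ) by norm_num,
          Real.rpow_natCast, Real.rpow_natCast]
        congr 2
        push_cast
        ring
    _ = 2 := by rw [this]; norm_num

lemma gauss_kernel (θ : ℝ) (hθ : θ ∈ Set.Icc 0 Real.pi) :
    ∫ p, relu p.1 * relu (Real.cos θ * p.1 + Real.sin θ * p.2)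
      ∂((gaussianReal 0 1).prod (gaussianReal 0 1))
      = 1 / (2 * Real.pi) * (Real.sin θ + (Real.pi - θ) * Real.cos θ) := by
  have hpi := Real.pi_pos
  rw [gaussianReal_of_var_ne_zero 0 one_ne_zero,
    prod_withDensity (measurable_gaussianPDF 0 1) (measurable_gaussianPDF 0 1),
    integral_withDensity_eq_integral_toReal_smul (by fun_prop)
      (Eventually.of_forall fun p => by simp [gaussianPDF, ENNReal.mul_lt_top])]
  rw [← Measure.volume_eq_prod, ← integral_comp_polarCoord_symm, polarCoord_target]
  have e : ∀ p ∈ Set.Ioi (0 : ℝ) ×ˢ Set.Ioo (-Real.pi) Real.pi,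
      p.1 • ((gaussianPDF 0 1 (polarCoord.symm p).1 * gaussianPDF 0 1 (polarCoord.symm p).2).toReal
        • (relu (polarCoord.symm p).1 * relu (Real.cos θ * (polarCoord.symm p).1
          + Real.sin θ * (polarCoord.symm p).2)))
      = (p.1 ^ 3 * Real.exp (-p.1 ^ 2 / 2)) *
        ((2 * Real.pi)⁻¹ * (relu (Real.cos p.2) * relu (Real.cos (p.2 - θ)))) := by
    rintro ⟨r, φ⟩ ⟨hr, _⟩
    have hr : 0 < r := hr
    rw [ENNReal.toReal_mul, toReal_gaussianPDF, toReal_gaussianPDF]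
    simp only [polarCoord_symm_apply, gaussianPDFReal, smul_eq_mul, NNReal.coe_one, mul_one,
      sub_zero]
    have e1 : Real.cos θ * (r * Real.cos φ) + Real.sin θ * (r * Real.sin φ)
        = r * Real.cos (φ - θ) := by rw [Real.cos_sub]; ring
    rw [e1, relu_mul hr.le, relu_mul hr.le]
    have e2 : Real.exp (-r ^ 2 / 2) = Real.exp (-(r * Real.cos φ) ^ 2 / 2)
        * Real.exp (-(r * Real.sin φ) ^ 2 / 2) := by
      rw [← Real.exp_add]
      congr 1
      have := Real.sin_sq_add_cos_sq φ
      linear_combination (r ^ 2 / 2) * this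
    have e3 : (2 * Real.pi)⁻¹ = (√(2 * Real.pi))⁻¹ * (√(2 * Real.pi))⁻¹ := by
      rw [← mul_inv, Real.mul_self_sqrt (by positivity)]
    rw [e2, e3]
    ring
  rw [setIntegral_congr_fun (measurableSet_Ioi.prod measurableSet_Ioo) e, Measure.volume_eq_prod,
    setIntegral_prod_mul (fun r : ℝ => r ^ 3 * Real.exp (-r ^ 2 / 2))
      (fun φ : ℝ => (2 * Real.pi)⁻¹ * (relu (Real.cos φ) * relu (Real.cos (φ - θ)))), radial,
    integral_const_mul, angular θ hθ]
  field_simp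

lemma fatou_weak {E : Type*} [MeasurableSpace E] [TopologicalSpace E] [HasOuterApproxClosed E]
    [OpensMeasurableSpace E] {μs : ℕ → ProbabilityMeasure E} {μ : ProbabilityMeasure E}
    (h : Tendsto μs atTop (nhds μ)) {g : E → ℝ} (hg : Continuous g) (hg0 : ∀ x, 0 ≤ g x)
    (hi : ∀ n, Integrable g (μs n : Measure E)) (hi' : Integrable g (μ : Measure E))
    {a : ℝ} (ha : a < ∫ x, g x ∂(μ : Measure E)) :
    ∀ᶠ n in atTop, a < ∫ x, g x ∂(μs n : Measure E) := by
  have key := lintegral_le_liminf_lintegral_of_forall_isOpen_measure_le_liminf_measure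
    (μ := (μ : Measure E)) (μs := fun n => (μs n : Measure E)) hg hg0
    (fun G hG => ProbabilityMeasure.le_liminf_measure_open_of_tendsto h hG)
  have e : ∀ ν : Measure E, Integrable g ν →
      ∫⁻ x, ENNReal.ofReal (g x) ∂ν = ENNReal.ofReal (∫ x, g x ∂ν) := fun ν hν =>
    (ofReal_integral_eq_lintegral_ofReal hν (Eventually.of_forall hg0)).symm
  rw [e _ hi'] at key
  simp only [fun n => e _ (hi n)] at key
  by_cases h0 : a < 0
  · exact Eventually.of_forall fun n => h0.trans_le (integral_nonneg hg0)
  push Not at h0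
  have h1 : ENNReal.ofReal a < ENNReal.ofReal (∫ x, g x ∂(μ : Measure E)) :=
    (ENNReal.ofReal_lt_ofReal_iff (h0.trans_lt ha)).2 ha
  have h2 := eventually_lt_of_lt_liminf (h1.trans_le key)
  filter_upwards [h2] with n hn
  exact (ENNReal.ofReal_lt_ofReal_iff_of_nonneg h0).1 hn

lemma weak_unbounded {E : Type*} [MeasurableSpace E] [TopologicalSpace E] [HasOuterApproxClosed E]
    [OpensMeasurableSpace E] {μs : ℕ → ProbabilityMeasure E} {μ : ProbabilityMeasure E}
    (h : Tendsto μs atTop (nhds μ)) {f q : E → ℝ} (hf : Continuous f) (hq : Continuous q)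
    (hf0 : ∀ x, 0 ≤ f x) (hfq : ∀ x, f x ≤ q x)
    (hi : ∀ n, Integrable q (μs n : Measure E)) (hi' : Integrable q (μ : Measure E))
    (hlim : Tendsto (fun n => ∫ x, q x ∂(μs n : Measure E)) atTop
      (nhds (∫ x, q x ∂(μ : Measure E)))) :
    Tendsto (fun n => ∫ x, f x ∂(μs n : Measure E)) atTop
      (nhds (∫ x, f x ∂(μ : Measure E))) := by
  have hfi : ∀ ν : Measure E, Integrable q ν → Integrable f ν := fun ν hν =>
    hν.mono' hf.measurable.aestronglyMeasurable
      (Eventually.of_forall fun x => by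
        rw [Real.norm_eq_abs, abs_of_nonneg (hf0 x)]; exact hfq x)
  rw [tendsto_order]
  constructor
  · intro a ha
    exact fatou_weak h hf hf0 (fun n => hfi _ (hi n)) (hfi _ hi') ha
  · intro b hb
    set ε := b - ∫ x, f x ∂(μ : Measure E) with hε
    have h1 := fatou_weak h (g := fun x => q x - f x) (hq.sub hf) (fun x => sub_nonneg.2 (hfq x))
      (fun n => (hi n).sub (hfi _ (hi n))) (hi'.sub (hfi _ hi'))
      (a := (∫ x, q x ∂(μ : Measure E)) - (∫ x, f x ∂(μ : Measure E)) - ε / 2) (by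
        rw [integral_sub hi' (hfi _ hi')]; linarith)
    have h2 := hlim.eventually_lt_const (u := (∫ x, q x ∂(μ : Measure E)) + ε / 2)
      (by linarith)
    filter_upwards [h1, h2] with n hn1 hn2
    rw [integral_sub (hi n) (hfi _ (hi n))] at hn1
    linarith

lemma integrable_sq_gauss : Integrable (fun x : ℝ => x ^ 2) (gaussianReal 0 1) :=
  (memLp_id_gaussianReal (μ := 0) (v := 1) 2).integrable_sq

lemma integrable_id_gauss : Integrable (fun x : ℝ => x) (gaussianReal 0 1) :=
  (memLp_id_gaussianReal (μ := 0) (v := 1) 1).integrable le_rfl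

lemma integral_sq_gauss : ∫ x : ℝ, x ^ 2 ∂(gaussianReal 0 1) = 1 := by
  have h := variance_fun_id_gaussianReal (μ := 0) (v := 1)
  rw [variance_eq_integral (by fun_prop)] at h
  simpa using h

lemma gauss_quad (c s : ℝ) (hcs : c ^ 2 + s ^ 2 = 1) :
    Integrable (fun p : ℝ × ℝ => p.1 ^ 2 + (c * p.1 + s * p.2) ^ 2)
      ((gaussianReal 0 1).prod (gaussianReal 0 1)) ∧
    ∫ p : ℝ × ℝ, p.1 ^ 2 + (c * p.1 + s * p.2) ^ 2
      ∂((gaussianReal 0 1).prod (gaussianReal 0 1)) = 2 := by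
  set γ := gaussianReal 0 1 with hγ
  have e : (fun p : ℝ × ℝ => p.1 ^ 2 + (c * p.1 + s * p.2) ^ 2)
      = fun p => ((1 + c ^ 2) * (p.1 ^ 2 * 1) + 2 * c * s * (p.1 * p.2))
        + s ^ 2 * (1 * p.2 ^ 2) := by
    funext p; ring
  have i1 : Integrable (fun p : ℝ × ℝ => p.1 ^ 2 * 1) (γ.prod γ) :=
    integrable_sq_gauss.mul_prod (g := fun _ : ℝ => (1 : ℝ)) (integrable_const 1)
  have i2 : Integrable (fun p : ℝ × ℝ => p.1 * p.2) (γ.prod γ) :=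
    integrable_id_gauss.mul_prod integrable_id_gauss
  have i3 : Integrable (fun p : ℝ × ℝ => 1 * p.2 ^ 2) (γ.prod γ) :=
    Integrable.mul_prod (f := fun _ : ℝ => (1 : ℝ)) (integrable_const 1) integrable_sq_gauss
  have v1 : ∫ p : ℝ × ℝ, p.1 ^ 2 * 1 ∂(γ.prod γ) = 1 := by
    rw [integral_prod_mul (fun x : ℝ => x ^ 2) (fun _ : ℝ => (1 : ℝ)), integral_sq_gauss]
    simp
  have v2 : ∫ p : ℝ × ℝ, p.1 * p.2 ∂(γ.prod γ) = 0 := by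
    rw [integral_prod_mul (fun x : ℝ => x) (fun x : ℝ => x), hγ, integral_id_gaussianReal]
    simp
  have v3 : ∫ p : ℝ × ℝ, 1 * p.2 ^ 2 ∂(γ.prod γ) = 1 := by
    rw [integral_prod_mul (fun _ : ℝ => (1 : ℝ)) (fun x : ℝ => x ^ 2), integral_sq_gauss]
    simp
  rw [e]
  refine ⟨((i1.const_mul _).add (i2.const_mul _)).add (i3.const_mul _), ?_⟩
  have k := ((i1.const_mul (1 + c ^ 2)).add (i2.const_mul (2 * c * s)))
  rw [integral_add (f := fun p : ℝ × ℝ => (1 + c ^ 2) * (p.1 ^ 2 * 1) + 2 * c * s * (p.1 * p.2))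
    k (i3.const_mul _), integral_add (i1.const_mul _) (i2.const_mul _), integral_const_mul, integral_const_mul,
    integral_const_mul, v1, v2, v3]
  linarith

lemma gauss_char (u : ℝ) : ∫ x : ℝ, Complex.exp (Complex.I * (u * x : ℝ)) ∂(gaussianReal 0 1)
    = Complex.exp (-(u ^ 2 / 2 : ℝ)) := by
  have h := charFun_gaussianReal (μ := 0) (v := 1) u
  rw [charFun_apply_real] at h
  calc _ = ∫ x : ℝ, Complex.exp (u * x * Complex.I) ∂(gaussianReal 0 1) := by
        refine integral_congr_ae (Eventually.of_forall fun x => ?_)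
        simp only
        push_cast
        congr 1
        ring
    _ = _ := by
        rw [h]
        push_cast
        congr 1
        simp

abbrev E2 := EuclideanSpace ℝ (Fin 2)

section limit

variable {Ω : Type*} [MeasurableSpace Ω] {P : Measure Ω} [IsProbabilityMeasure P]

noncomputable def limMap (V : Ω → ℝ) (c s : ℝ) (w : Ω × (ℝ × ℝ)) : E2 :=
  !₂[√(V w.1) * w.2.1, √(V w.1) * (c * w.2.1 + s * w.2.2)]

lemma measurable_vec {α : Type*} [MeasurableSpace α] {f g : α → ℝ} (hf : Measurable f)
    (hg : Measurable g) : Measurable (fun a => (!₂[f a, g a] : E2)) := by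
  refine (WithLp.measurable_toLp 2 _).comp (measurable_pi_iff.2 fun i => ?_)
  fin_cases i
  · simpa using hf
  · simpa using hg

lemma measurable_limMap {V : Ω → ℝ} (hV : Measurable V) (c s : ℝ) :
    Measurable (limMap V c s) := by
  unfold limMap
  apply measurable_vec <;> fun_prop

lemma inner_vec (a b : ℝ) (t : E2) : inner ℝ (!₂[a, b] : E2) t = t 0 * a + t 1 * b := by
  simp [PiLp.inner_apply, Fin.sum_univ_two]

lemma charFun_lim {V : Ω → ℝ} (hV : Measurable V) (hV0 : ∀ ω, 0 ≤ V ω) (c s : ℝ)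
    (hcs : c ^ 2 + s ^ 2 = 1) (t : E2) :
    charFun ((P.prod ((gaussianReal 0 1).prod (gaussianReal 0 1))).map (limMap V c s)) t
      = ∫ ω, Complex.exp (-((t 0 ^ 2 + t 1 ^ 2 + 2 * (t 0 * t 1 * c)) * V ω / 2 : ℝ)) ∂P := by
  rw [charFun_apply, integral_map (measurable_limMap hV c s).aemeasurable
    (Measurable.aestronglyMeasurable (by fun_prop))]
  have hm := measurable_limMap hV c s
  rw [integral_prod]
  swap
  · refine Integrable.of_bound (Measurable.aestronglyMeasurable (by fun_prop)) 1
      (Eventually.of_forall fun ω => ?_)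
    rw [Complex.norm_exp_ofReal_mul_I]
  refine integral_congr_ae (Eventually.of_forall fun ω => ?_)
  simp only [limMap, inner_vec]
  have e : ∀ p : ℝ × ℝ, Complex.exp (((t 0 * (√(V ω) * p.1)
      + t 1 * (√(V ω) * (c * p.1 + s * p.2)) : ℝ) : ℂ) * Complex.I)
      = Complex.exp (Complex.I * (√(V ω) * (t 0 + t 1 * c) * p.1 : ℝ))
        * Complex.exp (Complex.I * (√(V ω) * (t 1 * s) * p.2 : ℝ)) := by
    intro p
    rw [← Complex.exp_add]
    congr 1
    push_cast
    ring
  simp_rw [e]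
  rw [integral_prod_mul
    (fun x : ℝ => Complex.exp (Complex.I * (√(V ω) * (t 0 + t 1 * c) * x : ℝ)))
    (fun x : ℝ => Complex.exp (Complex.I * (√(V ω) * (t 1 * s) * x : ℝ))),
    gauss_char, gauss_char, ← Complex.exp_add, ← Complex.ofReal_neg, ← Complex.ofReal_neg,
    ← Complex.ofReal_neg, ← Complex.ofReal_add]
  congr 2
  rw [mul_pow, mul_pow, Real.sq_sqrt (hV0 ω)]
  linear_combination (-(V ω) * t 1 ^ 2 / 2) * hcs

lemma lim_quad {V : Ω → ℝ} (hV : Measurable V) (hV0 : ∀ ω, 0 ≤ V ω) (hVi : Integrable V P)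
    (c s : ℝ) (hcs : c ^ 2 + s ^ 2 = 1) :
    Integrable (fun x : E2 => x 0 ^ 2 + x 1 ^ 2)
      ((P.prod ((gaussianReal 0 1).prod (gaussianReal 0 1))).map (limMap V c s)) ∧
    ∫ x : E2, x 0 ^ 2 + x 1 ^ 2
      ∂((P.prod ((gaussianReal 0 1).prod (gaussianReal 0 1))).map (limMap V c s))
      = 2 * ∫ ω, V ω ∂P := by
  obtain ⟨g1, g2⟩ := gauss_quad c s hcs
  have hm := measurable_limMap hV c s
  have e : (fun w : Ω × (ℝ × ℝ) => (limMap V c s w) 0 ^ 2 + (limMap V c s w) 1 ^ 2)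
      = fun w => V w.1 * (w.2.1 ^ 2 + (c * w.2.1 + s * w.2.2) ^ 2) := by
    funext w
    simp only [limMap]
    simp only [Matrix.cons_val_zero, Matrix.cons_val_one]
    rw [mul_pow, mul_pow, Real.sq_sqrt (hV0 _)]
    ring
  have hsm : Measurable (fun x : E2 => x 0 ^ 2 + x 1 ^ 2) :=
    Continuous.measurable (by fun_prop)
  constructor
  · rw [integrable_map_measure hsm.aestronglyMeasurable hm.aemeasurable]
    change Integrable (fun w => (limMap V c s w) 0 ^ 2 + (limMap V c s w) 1 ^ 2) _
    rw [e]
    exact hVi.mul_prod g1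
  · rw [integral_map hm.aemeasurable hsm.aestronglyMeasurable, e,
      integral_prod_mul V (fun p : ℝ × ℝ => p.1 ^ 2 + (c * p.1 + s * p.2) ^ 2), g2]
    ring

lemma lim_relu {V : Ω → ℝ} (hV : Measurable V) (hV0 : ∀ ω, 0 ≤ V ω)
    (θ : ℝ) (hθ : θ ∈ Set.Icc 0 Real.pi) :
    ∫ x : E2, relu (x 0) * relu (x 1) ∂((P.prod
      ((gaussianReal 0 1).prod (gaussianReal 0 1))).map (limMap V (Real.cos θ) (Real.sin θ)))
      = (∫ ω, V ω ∂P) * (1 / (2 * Real.pi) * (Real.sin θ + (Real.pi - θ) * Real.cos θ)) := by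
  have hm := measurable_limMap hV (Real.cos θ) (Real.sin θ)
  have hr := continuous_relu
  have hsm : Measurable (fun x : E2 => relu (x 0) * relu (x 1)) :=
    Continuous.measurable (by fun_prop)
  rw [integral_map hm.aemeasurable hsm.aestronglyMeasurable, ← gauss_kernel θ hθ,
    ← integral_prod_mul]
  refine integral_congr_ae (Eventually.of_forall fun w => ?_)
  simp only [limMap]
  simp only [Matrix.cons_val_zero, Matrix.cons_val_one]
  rw [relu_mul (Real.sqrt_nonneg _), relu_mul (Real.sqrt_nonneg _)]
  have := Real.mul_self_sqrt (hV0 w.1)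
  linear_combination (relu w.2.1 * relu (Real.cos θ * w.2.1 + Real.sin θ * w.2.2)) * this

end limit

lemma decay_sup {x : (m : ℕ) → Fin m → ℝ}
    (hx : Tendsto (fun m : ℕ => (m : ℝ) ^ ((1 : ℝ) / 4) * ⨆ i : Fin m, |x m i|)
      atTop (nhds 0)) : Tendsto (fun m : ℕ => ⨆ i : Fin m, |x m i|) atTop (nhds 0) := by
  have h0 : ∀ m : ℕ, 0 ≤ ⨆ i : Fin m, |x m i| := fun m => Real.iSup_nonneg fun i => abs_nonneg _
  refine squeeze_zero' (Eventually.of_forall h0) ?_ hx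
  filter_upwards [eventually_ge_atTop 1] with m hm
  have : (1 : ℝ) ≤ (m : ℝ) ^ ((1 : ℝ) / 4) :=
    Real.one_le_rpow (by exact_mod_cast hm) (by norm_num)
  exact le_mul_of_one_le_left (h0 m) this

lemma cube_sum_le {m : ℕ} (z : Fin m → ℝ) (M : ℝ) (hM : ∀ i, |z i| ≤ M) :
    ∑ i, |z i| ^ 3 ≤ M * ∑ i, z i ^ 2 := by
  rw [Finset.mul_sum]
  refine Finset.sum_le_sum fun i _ => ?_
  rw [pow_succ', sq_abs]
  exact mul_le_mul_of_nonneg_right (hM i) (sq_nonneg _)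

section final

variable {Ω : Type*} [MeasurableSpace Ω] {P : Measure Ω} [IsProbabilityMeasure P]
  {W : ℕ → Ω → ℝ}

lemma sum_memLp (hW : ∀ i, Measurable (W i)) (hex : Exchangeable P W)
    (h2 : MemLp (W 0) 2 P) {m : ℕ} (x : Fin m → ℝ) :
    MemLp (fun ω => ∑ i : Fin m, W i ω * x i) 2 P :=
  memLp_finsetSum _ fun i _ => (exch_memLp hW hex h2 i).mul_const (x i)

lemma sum_sq_lim (hW : ∀ i, Measurable (W i)) (hex : Exchangeable P W)
    (h2 : MemLp (W 0) 2 P) (x : (m : ℕ) → Fin m → ℝ)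
    (hxunit : ∀ m, 2 ≤ m → ∑ i, x m i ^ 2 = 1)
    (hxsum : Tendsto (fun m : ℕ => ∑ i : Fin m, x m i) atTop (nhds 0)) :
    Tendsto (fun m : ℕ => ∫ ω, (∑ i : Fin m, W i ω * x m i) ^ 2 ∂P) atTop
      (nhds ((∫ ω, (W 0 ω) ^ 2 ∂P) - ∫ ω, W 0 ω * W 1 ω ∂P)) := by
  set a := ∫ ω, (W 0 ω) ^ 2 ∂P
  set b := ∫ ω, W 0 ω * W 1 ω ∂P
  have h : Tendsto (fun m : ℕ => 1 * (a - b) + (∑ i : Fin m, x m i) ^ 2 * b) atTop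
      (nhds (1 * (a - b) + 0 ^ 2 * b)) :=
    tendsto_const_nhds.add ((hxsum.pow 2).mul_const b)
  have e : 1 * (a - b) + 0 ^ 2 * b = a - b := by ring
  rw [e] at h
  refine h.congr' ?_
  filter_upwards [eventually_ge_atTop 2] with m hm
  rw [← hxunit m hm]
  simp_rw [mul_comm (W _ _)]
  exact (sq_moment Finset.univ (fun i : Fin m => W i) (fun i => exch_memLp hW hex h2 i) a b
    (fun i => exch_sq hW hex i)
    (fun i j hij => exch_mul hW hex i j (fun h => hij (Fin.ext h))) (x m)).symm

lemma char_lim (hW : ∀ i, Measurable (W i)) (hex : Exchangeable P W)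
    (h2 : MemLp (W 0) 2 P) (h3 : Integrable (fun ω => |W 0 ω| ^ 3) P) (V : Ω → ℝ)
    (hVm : Measurable V) (hV0 : ∀ ω, 0 ≤ V ω) (hVi : Integrable V P)
    (hV : ∀ ε > 0, ∃ N : ℕ, 0 < N ∧ ∀ S : Finset ℕ, N ≤ S.card →
        ∫ ω, |evar S (fun i => W i ω) - V ω| ∂P ≤ ε)
    (c : ℝ) (x y : (m : ℕ) → Fin m → ℝ)
    (hxunit : ∀ m, 2 ≤ m → ∑ i, x m i ^ 2 = 1)
    (hyunit : ∀ m, 2 ≤ m → ∑ i, y m i ^ 2 = 1)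
    (hangle : ∀ m, 2 ≤ m → ∑ i, x m i * y m i = c)
    (hxd : Tendsto (fun m : ℕ => ⨆ i : Fin m, |x m i|) atTop (nhds 0))
    (hyd : Tendsto (fun m : ℕ => ⨆ i : Fin m, |y m i|) atTop (nhds 0))
    (hxsum : Tendsto (fun m : ℕ => ∑ i : Fin m, x m i) atTop (nhds 0))
    (hysum : Tendsto (fun m : ℕ => ∑ i : Fin m, y m i) atTop (nhds 0)) (a b : ℝ) :
    Tendsto (fun m : ℕ => ∫ ω, Complex.exp (Complex.I *
        (∑ j : Fin m, (a * x m j + b * y m j) * W j ω : ℝ)) ∂P) atTop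
      (nhds (∫ ω, Complex.exp (-((a ^ 2 + b ^ 2 + 2 * (a * b * c)) * V ω / 2 : ℝ)) ∂P)) := by
  rw [tendsto_iff_norm_sub_tendsto_zero]
  set Q := a ^ 2 + b ^ 2 + 2 * (a * b * c) with hQ
  set C3 := ∫ ω, |W 0 ω| ^ 3 ∂P
  set C1 := ∫ ω, |W 0 ω| ∂P
  have hC3 : 0 ≤ C3 := integral_nonneg fun ω => by positivity
  have hsq : ∀ m, 2 ≤ m → ∑ j, (a * x m j + b * y m j) ^ 2 = Q := by
    intro m hm
    have e : ∀ j, (a * x m j + b * y m j) ^ 2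
        = a ^ 2 * x m j ^ 2 + b ^ 2 * y m j ^ 2 + 2 * (a * b) * (x m j * y m j) := fun j => by ring
    simp_rw [e]
    rw [Finset.sum_add_distrib, Finset.sum_add_distrib, ← Finset.mul_sum, ← Finset.mul_sum,
      ← Finset.mul_sum, hxunit m hm, hyunit m hm, hangle m hm, hQ]
    ring
  set M : ℕ → ℝ := fun m => |a| * (⨆ i : Fin m, |x m i|) + |b| * ⨆ i : Fin m, |y m i| with hM
  have hMlim : Tendsto (fun m => 33 * C3 * (M m * Q)
      + |a * (∑ i : Fin m, x m i) + b * ∑ i : Fin m, y m i| * C1) atTop (nhds 0) := by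
    have k1 : Tendsto M atTop (nhds (|a| * 0 + |b| * 0)) :=
      (hxd.const_mul _).add (hyd.const_mul _)
    have k2 : Tendsto (fun m => |a * (∑ i : Fin m, x m i) + b * ∑ i : Fin m, y m i|) atTop
        (nhds |a * 0 + b * 0|) := ((hxsum.const_mul _).add (hysum.const_mul _)).abs
    have k3 := ((k1.mul_const Q).const_mul (33 * C3)).add (k2.mul_const C1)
    simpa using k3
  refine squeeze_zero' (Eventually.of_forall fun m => norm_nonneg _) ?_ hMlim
  filter_upwards [eventually_ge_atTop 2] with m hm
  have hb := char_bound hW hex h2 h3 V hVm hV0 hVi hV (fun j => a * x m j + b * y m j)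
  rw [hsq m hm] at hb
  refine hb.trans ?_
  have hle : ∀ i, |a * x m i + b * y m i| ≤ M m := by
    intro i
    refine (abs_add_le _ _).trans ?_
    rw [abs_mul, abs_mul]
    exact add_le_add
      (mul_le_mul_of_nonneg_left (le_ciSup (f := fun i => |x m i|) (Set.finite_range _).bddAbove i)
        (abs_nonneg _))
      (mul_le_mul_of_nonneg_left (le_ciSup (f := fun i => |y m i|) (Set.finite_range _).bddAbove i)
        (abs_nonneg _))
  have hc := cube_sum_le (fun j => a * x m j + b * y m j) (M m) hle
  rw [hsq m hm] at hc
  have es : ∑ j, (a * x m j + b * y m j)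
      = a * (∑ i : Fin m, x m i) + b * ∑ i : Fin m, y m i := by
    rw [Finset.sum_add_distrib, Finset.mul_sum, Finset.mul_sum]
  rw [es]
  have := mul_le_mul_of_nonneg_left hc (show 0 ≤ 33 * C3 by positivity)
  linarith

end final

/-- For an exchangeable sequence `(Wᵢ)` with finite third moment and `E|W₁W₂| < ∞`, and
unit vectors `x̂₍ₘ₎, ŷ₍ₘ₎` at fixed angle `θ` satisfying the decay and zero-sum
conditions, the expectation `E[σ(W·x̂₍ₘ₎) σ(W·ŷ₍ₘ₎)]` converges to
`(1/2π)(E[W₁²] − E[W₁W₂])(sin θ + (π − θ) cos θ)`. -/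
theorem kernel_of_trained_mlp {Ω : Type*} [MeasurableSpace Ω] (P : Measure Ω)
    [IsProbabilityMeasure P] (W : ℕ → Ω → ℝ) (hWmeas : ∀ i, Measurable (W i))
    (hexch : Exchangeable P W)
    (hmom3 : Integrable (fun ω => |W 0 ω| ^ 3) P)
    (hmom12 : Integrable (fun ω => |W 0 ω * W 1 ω|) P)
    (θ : ℝ) (hθ : θ ∈ Set.Icc 0 Real.pi)
    (x y : (m : ℕ) → Fin m → ℝ)
    (hxunit : ∀ m, 2 ≤ m → ∑ i, x m i ^ 2 = 1)
    (hyunit : ∀ m, 2 ≤ m → ∑ i, y m i ^ 2 = 1)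
    (hangle : ∀ m, 2 ≤ m → ∑ i, x m i * y m i = Real.cos θ)
    (hxdecay : Tendsto (fun m : ℕ => (m : ℝ) ^ ((1 : ℝ) / 4) * ⨆ i : Fin m, |x m i|)
      atTop (nhds 0))
    (hydecay : Tendsto (fun m : ℕ => (m : ℝ) ^ ((1 : ℝ) / 4) * ⨆ i : Fin m, |y m i|)
      atTop (nhds 0))
    (hxsum : Tendsto (fun m : ℕ => ∑ i : Fin m, x m i) atTop (nhds 0))
    (hysum : Tendsto (fun m : ℕ => ∑ i : Fin m, y m i) atTop (nhds 0)) :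
    Tendsto (fun m : ℕ =>
        ∫ ω, relu (∑ i : Fin m, W i ω * x m i) * relu (∑ i : Fin m, W i ω * y m i) ∂P)
      atTop
      (nhds ((1 / (2 * Real.pi)) *
        ((∫ ω, (W 0 ω) ^ 2 ∂P) - ∫ ω, W 0 ω * W 1 ω ∂P) *
        (Real.sin θ + (Real.pi - θ) * Real.cos θ))) := by
  have h2 : MemLp (W 0) 2 P := by
    rw [memLp_two_iff_integrable_sq (hWmeas 0).aestronglyMeasurable]
    refine ((integrable_const (1 : ℝ)).add hmom3).mono' (by fun_prop)
      (Eventually.of_forall fun ω => ?_)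
    rw [Real.norm_eq_abs, abs_of_nonneg (sq_nonneg _), ← sq_abs]
    simp only [Pi.add_apply]
    have h0 := abs_nonneg (W 0 ω)
    by_cases h : |W 0 ω| ≤ 1
    · have : |W 0 ω| ^ 2 ≤ 1 := pow_le_one₀ h0 h
      have : 0 ≤ |W 0 ω| ^ 3 := by positivity
      linarith
    · have : |W 0 ω| ^ 2 ≤ |W 0 ω| ^ 3 := pow_le_pow_right₀ (le_of_not_ge h) (by norm_num)
      linarith
  obtain ⟨V, hVm, hV0, hVi, hVint, hV⟩ := exists_limit_var hWmeas hexch h2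
  set c := Real.cos θ with hc
  set s := Real.sin θ with hs
  have hcs : c ^ 2 + s ^ 2 = 1 := Real.cos_sq_add_sin_sq θ
  set X : ℕ → Ω → E2 := fun m ω => !₂[∑ i : Fin m, W i ω * x m i, ∑ i : Fin m, W i ω * y m i]
    with hX
  have hXm : ∀ m, Measurable (X m) := fun m => measurable_vec (by fun_prop) (by fun_prop)
  have hLm := measurable_limMap hVm c s
  set μs : ℕ → ProbabilityMeasure E2 := fun m =>
    ⟨P.map (X m), Measure.isProbabilityMeasure_map (hXm m).aemeasurable⟩ with hμs
  set μ : ProbabilityMeasure E2 :=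
    ⟨(P.prod ((gaussianReal 0 1).prod (gaussianReal 0 1))).map (limMap V c s),
      Measure.isProbabilityMeasure_map hLm.aemeasurable⟩ with hμ
  have hweak : Tendsto μs atTop (nhds μ) := by
    apply ProbabilityMeasure.tendsto_of_tendsto_charFun
    intro t
    have key := char_lim hWmeas hexch h2 hmom3 V hVm hV0 hVi hV c x y hxunit hyunit hangle
      (decay_sup hxdecay) (decay_sup hydecay) hxsum hysum (t 0) (t 1)
    rw [← charFun_lim hVm hV0 c s hcs t] at key
    refine key.congr fun m => ?_
    have hme := hXm m
    change _ = charFun (P.map (X m)) t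
    rw [charFun_apply, integral_map hme.aemeasurable
      (Measurable.aestronglyMeasurable (by fun_prop))]
    refine integral_congr_ae (Eventually.of_forall fun ω => ?_)
    simp only [hX, inner_vec]
    rw [mul_comm]
    congr 3
    rw [Finset.mul_sum, Finset.mul_sum, ← Finset.sum_add_distrib]
    exact Finset.sum_congr rfl fun j _ => by ring
  have hr := continuous_relu
  have hqc : Continuous (fun v : E2 => v 0 ^ 2 + v 1 ^ 2) := by fun_prop
  have hfc : Continuous (fun v : E2 => relu (v 0) * relu (v 1)) := by fun_prop
  obtain ⟨l1, l2⟩ := lim_quad (P := P) hVm hV0 hVi c s hcs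
  have hSx := fun m => (sum_memLp hWmeas hexch h2 (x m)).integrable_sq
  have hSy := fun m => (sum_memLp hWmeas hexch h2 (y m)).integrable_sq
  have hqi : ∀ m, Integrable (fun v : E2 => v 0 ^ 2 + v 1 ^ 2) (μs m : Measure E2) := by
    intro m
    change Integrable _ (P.map (X m))
    rw [integrable_map_measure hqc.measurable.aestronglyMeasurable (hXm m).aemeasurable]
    exact (hSx m).add (hSy m)
  have hqlim : Tendsto (fun m => ∫ v : E2, v 0 ^ 2 + v 1 ^ 2 ∂(μs m : Measure E2)) atTop
      (nhds (∫ v : E2, v 0 ^ 2 + v 1 ^ 2 ∂(μ : Measure E2))) := by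
    change Tendsto _ _ (nhds (∫ v : E2, v 0 ^ 2 + v 1 ^ 2
      ∂((P.prod ((gaussianReal 0 1).prod (gaussianReal 0 1))).map (limMap V c s))))
    rw [l2, two_mul, hVint]
    refine ((sum_sq_lim hWmeas hexch h2 x hxunit hxsum).add
      (sum_sq_lim hWmeas hexch h2 y hyunit hysum)).congr fun m => ?_
    change _ = ∫ v : E2, v 0 ^ 2 + v 1 ^ 2 ∂(P.map (X m))
    rw [integral_map (hXm m).aemeasurable hqc.measurable.aestronglyMeasurable,
      ← integral_add (hSx m) (hSy m)]
    rfl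
  have main := weak_unbounded hweak hfc hqc
    (fun v => mul_nonneg (relu_nonneg _) (relu_nonneg _))
    (fun v => by
      have a1 := mul_le_mul (relu_le_abs (v 0)) (relu_le_abs (v 1)) (relu_nonneg _) (abs_nonneg _)
      have a2 := sq_abs (v 0)
      have a3 := sq_abs (v 1)
      nlinarith [sq_nonneg (|v 0| - |v 1|), sq_nonneg (|v 0| + |v 1|)])
    hqi l1 hqlim
  have hlr := lim_relu (P := P) hVm hV0 θ hθ
  have e : (∫ v : E2, relu (v 0) * relu (v 1) ∂(μ : Measure E2))
      = 1 / (2 * Real.pi) * ((∫ ω, (W 0 ω) ^ 2 ∂P) - ∫ ω, W 0 ω * W 1 ω ∂P) *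
        (s + (Real.pi - θ) * c) := by
    rw [← hVint]
    refine hlr.trans ?_
    ring
  rw [e] at main
  refine main.congr fun m => ?_
  change ∫ v : E2, relu (v 0) * relu (v 1) ∂(P.map (X m)) = _
  rw [integral_map (hXm m).aemeasurable hfc.measurable.aestronglyMeasurable]
  rfl
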